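/- arXiv:1110.6611 — 9 statements merged into one kernel-verified Lean document; each statement's English description precedes it below -/
import Mathlib

section
/- Let T = (T₁,T₂) be a commuting 2-variable weighted shift in the class TC. Then the following are equivalent: (i) (T₁,T₂) is a subnormal pair; (ii) for all integers m,n ≥ 1, the power T^{(m,n)} = (T₁ᵐ,T₂ⁿ) is a subnormal pair; (iii) for some integers m,n ≥ 1, T^{(m,n)} = (T₁ᵐ,T₂ⁿ) is a subnormal pair. -/
open MeasureTheory
open scoped ENNReal

noncomputable section

/-- The Hilbert space `ℓ²(ℤ₊²)`. -/
abbrev H2 : Type := lp (fun _ : ℕ × ℕ => ℂ) 2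

/-- The canonical orthonormal basis vectors of `ℓ²(ℤ₊²)`. -/
noncomputable def e2 (k : ℕ × ℕ) : H2 := lp.single 2 k 1

/-- A bounded operator is subnormal if it has a normal extension. -/
def IsSubnormalOp {H : Type} [NormedAddCommGroup H] [InnerProductSpace ℂ H]
    (S : H →L[ℂ] H) : Prop :=
  ∃ (K : Type) (_ : NormedAddCommGroup K) (_ : InnerProductSpace ℂ K)
    (_ : CompleteSpace K) (V : H →ₗᵢ[ℂ] K) (N : K →L[ℂ] K),
      IsStarNormal N ∧ ∀ x : H, N (V x) = V (S x)

/-- A pair of operators is a subnormal pair if it has a commuting normal extension. -/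
def IsSubnormalPair {H : Type} [NormedAddCommGroup H] [InnerProductSpace ℂ H]
    (T₁ T₂ : H →L[ℂ] H) : Prop :=
  ∃ (K : Type) (_ : NormedAddCommGroup K) (_ : InnerProductSpace ℂ K)
    (_ : CompleteSpace K) (V : H →ₗᵢ[ℂ] K) (N₁ N₂ : K →L[ℂ] K),
      IsStarNormal N₁ ∧ IsStarNormal N₂ ∧ N₁ * N₂ = N₂ * N₁ ∧
      (∀ x : H, N₁ (V x) = V (T₁ x)) ∧ (∀ x : H, N₂ (V x) = V (T₂ x))

open scoped InnerProductSpace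

section Operators
variable {K K' : Type*} [NormedAddCommGroup K] [InnerProductSpace ℂ K] [CompleteSpace K]
  [NormedAddCommGroup K'] [InnerProductSpace ℂ K'] [CompleteSpace K']

/-- For normal `N`, the norm `‖N ^ k w‖` is determined by the positive operator `N⋆ N`. -/
theorem norm_sq_pow_apply_eq_inner (N : K →L[ℂ] K) (hN : IsStarNormal N) (k : ℕ) (w : K) :
    ‖(N ^ k) w‖ ^ 2 = (⟪((star N * N) ^ k) w, w⟫_ℂ).re := by
  have h : (star N * N) ^ k = star (N ^ k) * N ^ k := by
    rw [hN.star_comm_self.mul_pow, star_pow]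
  rw [h, ContinuousLinearMap.star_eq_adjoint]
  exact ContinuousLinearMap.apply_norm_sq_eq_inner_adjoint_left (N ^ k) w

theorem exists_isSelfAdjoint_norm_pow_mul_apply (N : K →L[ℂ] K) (hN : IsStarNormal N)
    {m : ℕ} (hm : m ≠ 0) :
    ∃ P : K →L[ℂ] K, IsSelfAdjoint P ∧ (∀ k w, ‖(P ^ (m * k)) w‖ = ‖(N ^ k) w‖) ∧
      ∀ B, Commute (star N * N) B → Commute P B := by
  have hP : IsSelfAdjoint (cfc (fun x : ℝ => |x| ^ (1 / (2 * m) : ℝ)) (star N * N)) :=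
    cfc_predicate _ _
  refine ⟨_, hP, fun k w => ?_, fun B hB => hB.cfc_real _⟩
  set P := cfc (fun x : ℝ => |x| ^ (1 / (2 * m) : ℝ)) (star N * N) with hPdef
  have hcont : Continuous fun x : ℝ => |x| ^ (1 / (2 * m) : ℝ) :=
    continuous_abs.rpow_const fun _ => Or.inr (by positivity)
  have hroot : P ^ (2 * m) = star N * N := by
    rw [hPdef, ← cfc_pow _ _ _ hcont.continuousOn]
    conv_rhs => rw [← cfc_id' ℝ (star N * N)]
    refine cfc_congr fun x hx => ?_
    have hx0 : 0 ≤ x := spectrum_star_mul_self_nonneg x hx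
    have hm' : (m : ℝ) ≠ 0 := by exact_mod_cast hm
    rw [← Real.rpow_natCast, ← Real.rpow_mul (abs_nonneg x), abs_of_nonneg hx0]
    push_cast
    rw [one_div_mul_cancel (by positivity), Real.rpow_one]
  have h : ‖(P ^ (m * k)) w‖ ^ 2 = ‖(N ^ k) w‖ ^ 2 := by
    rw [norm_sq_pow_apply_eq_inner P hP.isStarNormal, norm_sq_pow_apply_eq_inner N hN,
      hP.star_eq, ← hroot, ← sq, ← pow_mul, ← pow_mul, mul_assoc]
  exact (sq_eq_sq₀ (norm_nonneg _) (norm_nonneg _)).mp h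

theorem exists_polynomial_near_pow (R : ℝ) (k : ℕ) {m : ℕ} (hm : m ≠ 0) {ε : ℝ} (hε : 0 < ε) :
    ∃ q : Polynomial ℝ, ∀ x : ℝ, |x| ≤ R → |q.eval (x ^ (2 * m)) - x ^ (2 * k)| ≤ ε := by
  have hm' : (m : ℝ) ≠ 0 := by exact_mod_cast hm
  obtain ⟨q, hq⟩ := exists_polynomial_near_of_continuousOn 0 (R ^ (2 * m))
    (fun y => y ^ (k / m : ℝ))
    (Real.continuous_rpow_const (by positivity)).continuousOn ε hε
  refine ⟨q, fun x hx => ?_⟩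
  have hmem : x ^ (2 * m) ∈ Set.Icc 0 (R ^ (2 * m)) := by
    rw [← Even.pow_abs (even_two_mul m) x]
    exact ⟨by positivity, pow_le_pow_left₀ (abs_nonneg x) hx _⟩
  have := hq _ hmem
  have he : (x ^ (2 * m)) ^ (k / m : ℝ) = x ^ (2 * k) := by
    rw [pow_mul, pow_mul, ← Real.rpow_natCast, ← Real.rpow_mul (sq_nonneg x),
      mul_div_cancel₀ _ hm', Real.rpow_natCast]
  rw [he] at this
  exact this.le

theorem norm_aeval_le_of_isSelfAdjoint {P : K →L[ℂ] K} (hP : IsSelfAdjoint P) {R ε : ℝ}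
    (hR : ‖P‖ ≤ R) (hε : 0 ≤ ε) (q : Polynomial ℝ) (hq : ∀ x : ℝ, |x| ≤ R → |q.eval x| ≤ ε) :
    ‖Polynomial.aeval P q‖ ≤ ε := by
  rw [← cfc_polynomial q P hP]
  refine norm_cfc_le hε fun x hx => hq x ?_
  have : ‖x‖ ≤ ‖P‖ * ‖(1 : K →L[ℂ] K)‖ := spectrum.norm_le_norm_mul_of_mem hx
  calc |x| = ‖x‖ := rfl
    _ ≤ ‖P‖ * ‖(1 : K →L[ℂ] K)‖ := this
    _ ≤ ‖P‖ * 1 := by gcongr; exact ContinuousLinearMap.norm_id_le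
    _ ≤ R := by simpa using hR

theorem re_inner_aeval_eq_of_norm_pow_eq {P : K →L[ℂ] K} {C : K' →L[ℂ] K'}
    (hP : IsSelfAdjoint P) (hC : IsSelfAdjoint C) {m : ℕ} {w : K} {u : K'}
    (h : ∀ j, ‖(P ^ (m * j)) w‖ = ‖(C ^ (m * j)) u‖) (q : Polynomial ℝ) :
    (⟪Polynomial.aeval (P ^ (2 * m)) q w, w⟫_ℂ).re =
      (⟪Polynomial.aeval (C ^ (2 * m)) q u, u⟫_ℂ).re := by
  induction q using Polynomial.induction_on' with
  | add p q hp hq => simp [hp, hq]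
  | monomial n a =>
    have hP' := norm_sq_pow_apply_eq_inner P hP.isStarNormal (m * n) w
    have hC' := norm_sq_pow_apply_eq_inner C hC.isStarNormal (m * n) u
    rw [hP.star_eq, ← sq, ← pow_mul, ← mul_assoc] at hP'
    rw [hC.star_eq, ← sq, ← pow_mul, ← mul_assoc] at hC'
    rw [Polynomial.aeval_monomial, Polynomial.aeval_monomial, ← pow_mul, ← pow_mul,
      ← Algebra.smul_def, ← Algebra.smul_def, smul_apply, smul_apply, inner_smul_left_eq_smul, inner_smul_left_eq_smul,
      Complex.smul_re, Complex.smul_re, ← hP', ← hC', h]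

theorem abs_re_inner_aeval_sub_norm_sq_le {P : K →L[ℂ] K} (hP : IsSelfAdjoint P) {R ε : ℝ}
    (hR : ‖P‖ ≤ R) (hε : 0 ≤ ε) {m k : ℕ} {q : Polynomial ℝ}
    (hq : ∀ x : ℝ, |x| ≤ R → |q.eval (x ^ (2 * m)) - x ^ (2 * k)| ≤ ε) (w : K) :
    |(⟪Polynomial.aeval (P ^ (2 * m)) q w, w⟫_ℂ).re - ‖(P ^ k) w‖ ^ 2| ≤ ε * ‖w‖ ^ 2 := by
  have hQ := norm_aeval_le_of_isSelfAdjoint hP hR hε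
    (q.comp (Polynomial.X ^ (2 * m)) - Polynomial.X ^ (2 * k))
    (fun x hx => by simpa using hq x hx)
  rw [map_sub, Polynomial.aeval_comp, map_pow, map_pow, Polynomial.aeval_X] at hQ
  rw [norm_sq_pow_apply_eq_inner P hP.isStarNormal k w, hP.star_eq, ← sq, ← pow_mul,
    ← Complex.sub_re, ← inner_sub_left, ← sub_apply]
  calc _ ≤ ‖⟪(Polynomial.aeval (P ^ (2 * m)) q - P ^ (2 * k)) w, w⟫_ℂ‖ := Complex.abs_re_le_norm _
    _ ≤ ‖(Polynomial.aeval (P ^ (2 * m)) q - P ^ (2 * k)) w‖ * ‖w‖ := norm_inner_le_norm _ _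
    _ ≤ ε * ‖w‖ * ‖w‖ := by
      gcongr
      exact ContinuousLinearMap.le_of_opNorm_le _ hQ w
    _ = ε * ‖w‖ ^ 2 := by ring

/-- The moments `‖P ^ k w‖` of a self-adjoint operator are determined by those whose index is a
multiple of a fixed `m ≠ 0`. -/
theorem norm_pow_apply_eq_of_norm_pow_mul_apply_eq {P : K →L[ℂ] K} {C : K' →L[ℂ] K'}
    (hP : IsSelfAdjoint P) (hC : IsSelfAdjoint C) {m : ℕ} (hm : m ≠ 0) {w : K} {u : K'}
    (h : ∀ j, ‖(P ^ (m * j)) w‖ = ‖(C ^ (m * j)) u‖) (k : ℕ) :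
    ‖(P ^ k) w‖ = ‖(C ^ k) u‖ := by
  have hclose : ∀ ε > 0, |‖(P ^ k) w‖ ^ 2 - ‖(C ^ k) u‖ ^ 2| ≤ ε * (‖w‖ ^ 2 + ‖u‖ ^ 2) := by
    intro ε hε
    obtain ⟨q, hq⟩ := exists_polynomial_near_pow (max ‖P‖ ‖C‖) k hm hε
    have h₁ := abs_re_inner_aeval_sub_norm_sq_le hP (le_max_left _ _) hε.le hq w
    have h₂ := abs_re_inner_aeval_sub_norm_sq_le hC (le_max_right _ _) hε.le hq u
    rw [re_inner_aeval_eq_of_norm_pow_eq hP hC h] at h₁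
    rw [abs_le] at *
    constructor <;> linarith [h₁.1, h₁.2, h₂.1, h₂.2]
  have hsq : ‖(P ^ k) w‖ ^ 2 = ‖(C ^ k) u‖ ^ 2 := by
    refine eq_of_abs_sub_nonpos (le_of_forall_pos_le_add fun δ hδ => ?_)
    refine (hclose (δ / (‖w‖ ^ 2 + ‖u‖ ^ 2 + 1)) (by positivity)).trans ?_
    rw [zero_add, div_mul_eq_mul_div, div_le_iff₀ (by positivity)]
    nlinarith
  exact (sq_eq_sq₀ (norm_nonneg _) (norm_nonneg _)).mp hsq

end Operators

section Shift
variable {K : Type*} [NormedAddCommGroup K] [InnerProductSpace ℂ K]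

/-- Translation by `d` on `ℓ²(G; K)`. -/
def lpTranslate {G : Type*} [AddCommGroup G] (d : G) :
    lp (fun _ : G => K) 2 →ₗᵢ[ℂ] lp (fun _ : G => K) 2 where
  toFun f := ⟨fun i => f (i - d), memℓp_gen
    ((Equiv.subRight d).summable_iff.mpr ((lp.memℓp f).summable (by simp)))⟩
  map_add' f g := by ext; rfl
  map_smul' c f := by ext; rfl
  norm_map' f := by
    rw [lp.norm_eq_tsum_rpow (by simp), lp.norm_eq_tsum_rpow (by simp)]
    congr 1
    exact (Equiv.subRight d).tsum_eq fun i => ‖f i‖ ^ (2 : ℝ≥0∞).toReal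

/-- The translation by `d` on `ℓ²(G; K)` followed by `P` in each coordinate. -/
def operatorShift {G : Type*} [AddCommGroup G] (d : G) (P : K →L[ℂ] K) :
    lp (fun _ : G => K) 2 →L[ℂ] lp (fun _ : G => K) 2 :=
  (lp.mapCLM 2 (fun _ => P) (norm_nonneg P) fun _ => le_rfl) ∘L
    (lpTranslate d).toContinuousLinearMap

theorem operatorShift_apply {G : Type*} [AddCommGroup G] (d : G) (P : K →L[ℂ] K)
    (f : lp (fun _ : G => K) 2) (i : G) : operatorShift d P f i = P (f (i - d)) := rfl

theorem operatorShift_mul {G : Type*} [AddCommGroup G] (d d' : G) (P P' : K →L[ℂ] K) :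
    operatorShift d P * operatorShift d' P' = operatorShift (d + d') (P * P') := by
  ext f i
  simp [operatorShift_apply, sub_sub]

theorem star_operatorShift [CompleteSpace K] {G : Type*} [AddCommGroup G] (d : G)
    (P : K →L[ℂ] K) : star (operatorShift d P) = operatorShift (-d) (star P) := by
  refine ((ContinuousLinearMap.eq_adjoint_iff _ _).mpr fun f g => ?_).symm
  rw [lp.inner_eq_tsum, lp.inner_eq_tsum,
    ← (Equiv.subRight d).tsum_eq fun i => ⟪operatorShift (-d) (star P) f i, g i⟫_ℂ]
  refine tsum_congr fun i => ?_
  simp [operatorShift_apply, ContinuousLinearMap.star_eq_adjoint,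
    ContinuousLinearMap.adjoint_inner_left]

theorem operatorShift_single {G : Type*} [AddCommGroup G] [DecidableEq G] (d : G)
    (P : K →L[ℂ] K) (i : G) (x : K) :
    operatorShift d P (lp.single 2 i x) = lp.single 2 (i + d) (P x) := by
  ext j
  rw [operatorShift_apply, lp.single_apply, lp.single_apply]
  by_cases h : j = i + d
  · subst h
    simp
  · have h' : j - d ≠ i := fun h' => h (by rw [← h', sub_add_cancel])
    simp [h, h']

theorem isStarNormal_operatorShift [CompleteSpace K] {G : Type*} [AddCommGroup G] (d : G)
    {P : K →L[ℂ] K} (hP : IsSelfAdjoint P) : IsStarNormal (operatorShift d P) := by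
  constructor
  rw [Commute, SemiconjBy, star_operatorShift, hP.star_eq, operatorShift_mul, operatorShift_mul,
    add_comm]

theorem commute_operatorShift {G : Type*} [AddCommGroup G] (d d' : G)
    {P P' : K →L[ℂ] K} (h : Commute P P') :
    Commute (operatorShift d P) (operatorShift d' P') := by
  rw [Commute, SemiconjBy, operatorShift_mul, operatorShift_mul, add_comm, h.eq]

end Shift

section Subnormal
variable {H : Type} [NormedAddCommGroup H] [InnerProductSpace ℂ H]

theorem pow_apply_isometry {K : Type*} [NormedAddCommGroup K] [InnerProductSpace ℂ K]
    {S : H →L[ℂ] H} {V : H →ₗᵢ[ℂ] K} {N : K →L[ℂ] K} (h : ∀ x, N (V x) = V (S x))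
    (k : ℕ) (x : H) : (N ^ k) (V x) = V ((S ^ k) x) := by
  induction k generalizing x with
  | zero => rfl
  | succ k ih => rw [pow_succ, pow_succ, mul_apply_eq_comp, h, ih,
      mul_apply_eq_comp]

theorem IsSubnormalPair.pow {T₁ T₂ : H →L[ℂ] H} (h : IsSubnormalPair T₁ T₂) (m n : ℕ) :
    IsSubnormalPair (T₁ ^ m) (T₂ ^ n) := by
  obtain ⟨K, i₁, i₂, i₃, V, N₁, N₂, hN₁, hN₂, hcomm, h₁, h₂⟩ := h
  have hpow : ∀ (N : K →L[ℂ] K) (k : ℕ), IsStarNormal N → IsStarNormal (N ^ k) := fun N k hN =>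
    ⟨by rw [star_pow]; exact hN.star_comm_self.pow_pow k k⟩
  exact ⟨K, i₁, i₂, i₃, V, N₁ ^ m, N₂ ^ n, hpow _ _ hN₁, hpow _ _ hN₂,
    Commute.pow_pow hcomm m n, pow_apply_isometry h₁ m, pow_apply_isometry h₂ n⟩

theorem IsSubnormalOp.exists_norm_pow_eq {S : H →L[ℂ] H} (h : IsSubnormalOp S) :
    ∃ (K : Type) (_ : NormedAddCommGroup K) (_ : InnerProductSpace ℂ K) (_ : CompleteSpace K)
      (V : H →ₗᵢ[ℂ] K) (C : K →L[ℂ] K), IsSelfAdjoint C ∧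
        ∀ (k : ℕ) (x : H), ‖(C ^ k) (V x)‖ = ‖(S ^ k) x‖ := by
  obtain ⟨K, i₁, i₂, i₃, V, N, hN, hV⟩ := h
  obtain ⟨C, hC, hnorm, -⟩ := exists_isSelfAdjoint_norm_pow_mul_apply N hN one_ne_zero
  refine ⟨K, i₁, i₂, i₃, V, C, hC, fun k x => ?_⟩
  have := hnorm k (V x)
  rw [one_mul] at this
  rw [this, pow_apply_isometry hV, V.norm_map]

/-- Moduli roots of a commuting normal extension of `(T₁ ^ m, T₂ ^ n)`. -/
theorem IsSubnormalPair.exists_norm_pow_eq {T₁ T₂ : H →L[ℂ] H} {m n : ℕ} (hm : m ≠ 0)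
    (hn : n ≠ 0) (h : IsSubnormalPair (T₁ ^ m) (T₂ ^ n)) :
    ∃ (K : Type) (_ : NormedAddCommGroup K) (_ : InnerProductSpace ℂ K) (_ : CompleteSpace K)
      (V : H →ₗᵢ[ℂ] K) (P₁ P₂ : K →L[ℂ] K), IsSelfAdjoint P₁ ∧ IsSelfAdjoint P₂ ∧
        Commute P₁ P₂ ∧ ∀ (k l : ℕ) (x : H),
          ‖(P₁ ^ (m * k)) ((P₂ ^ (n * l)) (V x))‖ = ‖(T₁ ^ (m * k)) ((T₂ ^ (n * l)) x)‖ := by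
  obtain ⟨K, i₁, i₂, i₃, V, N₁, N₂, hN₁, hN₂, hcomm, h₁, h₂⟩ := h
  have hc : Commute N₁ N₂ := hcomm
  have hA₁ : Commute (star N₁ * N₁) N₂ := (hN₁.commute_star_left hc).mul_left hc
  have hA : Commute (star N₂ * N₂) (star N₁ * N₁) :=
    (hN₂.commute_star_left hA₁.symm).mul_left hA₁.symm
  obtain ⟨P₁, hP₁, hnorm₁, hcomm₁⟩ := exists_isSelfAdjoint_norm_pow_mul_apply N₁ hN₁ hm
  obtain ⟨P₂, hP₂, hnorm₂, hcomm₂⟩ := exists_isSelfAdjoint_norm_pow_mul_apply N₂ hN₂ hn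
  have hP : Commute P₁ P₂ := hcomm₁ _ (hcomm₂ _ hA).symm
  refine ⟨K, i₁, i₂, i₃, V, P₁, P₂, hP₁, hP₂, hP, fun k l x => ?_⟩
  have e₁ : (P₁ ^ (m * k)) ((P₂ ^ (n * l)) (V x)) = (P₂ ^ (n * l)) ((P₁ ^ (m * k)) (V x)) :=
    DFunLike.congr_fun (hP.pow_pow (m * k) (n * l)).eq (V x)
  have e₂ : (N₂ ^ l) ((P₁ ^ (m * k)) (V x)) = (P₁ ^ (m * k)) ((N₂ ^ l) (V x)) :=
    DFunLike.congr_fun ((hcomm₁ _ hA₁).symm.pow_pow l (m * k)).eq (V x)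
  rw [e₁, hnorm₂, e₂, hnorm₁, pow_apply_isometry h₂, pow_apply_isometry h₁, V.norm_map,
    ← pow_mul, ← pow_mul]

end Subnormal

section WeightedShift

theorem orthonormal_single_intCast {K : Type*} [NormedAddCommGroup K] [InnerProductSpace ℂ K]
    {v : ℕ × ℕ → K} (hv : ∀ k, ‖v k‖ = 1) :
    Orthonormal ℂ fun k : ℕ × ℕ =>
      (lp.single 2 ((k.1 : ℤ), (k.2 : ℤ)) (v k) : lp (fun _ : ℤ × ℤ => K) 2) := by
  refine ⟨fun k => by rw [lp.norm_single (by simp), hv], fun k l hkl => ?_⟩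
  dsimp only
  rw [lp.inner_single_left, lp.single_apply_ne, inner_zero_right]
  intro h
  apply hkl
  simpa [Prod.ext_iff] using h

theorem eq_on_H2_of_eq_on_e2 {K : Type*} [NormedAddCommGroup K] [InnerProductSpace ℂ K]
    {f g : H2 →L[ℂ] K} (h : ∀ k, f (e2 k) = g (e2 k)) : f = g := by
  refine lp.ext_continuousLinearMap (by simp) fun k => ?_
  ext
  simpa [e2] using h k

/-- A 2-variable weighted shift whose moments `g` are realized by commuting self-adjoint operators
is a subnormal pair. -/
theorem isSubnormalPair_of_norm_pow_eq {α β g : ℕ × ℕ → ℝ} {T₁ T₂ : H2 →L[ℂ] H2}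
    (hT₁ : ∀ k : ℕ × ℕ, T₁ (e2 k) = (α k : ℂ) • e2 (k.1 + 1, k.2))
    (hT₂ : ∀ k : ℕ × ℕ, T₂ (e2 k) = (β k : ℂ) • e2 (k.1, k.2 + 1))
    (hg : ∀ k, 0 < g k) (hgα : ∀ k, g (k.1 + 1, k.2) = α k * g k)
    (hgβ : ∀ k, g (k.1, k.2 + 1) = β k * g k)
    {K : Type} [NormedAddCommGroup K] [InnerProductSpace ℂ K] [CompleteSpace K]
    {P₁ P₂ : K →L[ℂ] K} (hP₁ : IsSelfAdjoint P₁) (hP₂ : IsSelfAdjoint P₂)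
    (hP : Commute P₁ P₂) {v : K} (hv : ∀ k : ℕ × ℕ, ‖(P₁ ^ k.1) ((P₂ ^ k.2) v)‖ = g k) :
    IsSubnormalPair T₁ T₂ := by
  set x : ℕ × ℕ → K := fun k => ((g k)⁻¹ : ℂ) • (P₁ ^ k.1) ((P₂ ^ k.2) v) with hx
  have hg' : ∀ k, (g k : ℂ) ≠ 0 := fun k => by exact_mod_cast (hg k).ne'
  have hx1 : ∀ k, ‖x k‖ = 1 := fun k => by
    rw [hx, norm_smul, hv, norm_inv, Complex.norm_of_nonneg (hg k).le,
      inv_mul_cancel₀ (hg k).ne']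
  have hx₁ : ∀ k, P₁ (x k) = (α k : ℂ) • x (k.1 + 1, k.2) := fun k => by
    have hα : (α k : ℂ) ≠ 0 := fun h0 => hg' (k.1 + 1, k.2) (by rw [hgα]; push_cast; simp [h0])
    simp only [hx]
    rw [map_smul, smul_smul, hgα, pow_succ', mul_apply_eq_comp]
    push_cast
    rw [mul_inv, mul_inv_cancel_left₀ hα]
  have hx₂ : ∀ k, P₂ (x k) = (β k : ℂ) • x (k.1, k.2 + 1) := fun k => by
    have hβ : (β k : ℂ) ≠ 0 := fun h0 => hg' (k.1, k.2 + 1) (by rw [hgβ]; push_cast; simp [h0])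
    have hc : P₂ ((P₁ ^ k.1) ((P₂ ^ k.2) v)) = (P₁ ^ k.1) (P₂ ((P₂ ^ k.2) v)) :=
      DFunLike.congr_fun (hP.symm.pow_right k.1).eq ((P₂ ^ k.2) v)
    simp only [hx]
    rw [map_smul, smul_smul, hgβ, pow_succ', mul_apply_eq_comp, hc]
    push_cast
    rw [mul_inv, mul_inv_cancel_left₀ hβ]
  have hV := (orthonormal_single_intCast hx1).orthogonalFamily
  have hVe : ∀ k, hV.linearIsometry (e2 k) = lp.single 2 ((k.1 : ℤ), (k.2 : ℤ)) (x k) :=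
    fun k => by
      rw [e2, hV.linearIsometry_apply_single]
      simp
  refine ⟨lp (fun _ : ℤ × ℤ => K) 2, inferInstance, inferInstance, inferInstance,
    hV.linearIsometry, operatorShift (1, 0) P₁, operatorShift (0, 1) P₂,
    isStarNormal_operatorShift _ hP₁, isStarNormal_operatorShift _ hP₂,
    (commute_operatorShift _ _ hP).eq, fun y => ?_, fun y => ?_⟩
  · have h := eq_on_H2_of_eq_on_e2
      (f := operatorShift (1, 0) P₁ ∘L hV.linearIsometry.toContinuousLinearMap)
      (g := hV.linearIsometry.toContinuousLinearMap ∘L T₁) fun k => by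
        simp [hVe, hT₁, operatorShift_single, hx₁, lp.single_smul]
    exact DFunLike.congr_fun h y
  · have h := eq_on_H2_of_eq_on_e2
      (f := operatorShift (0, 1) P₂ ∘L hV.linearIsometry.toContinuousLinearMap)
      (g := hV.linearIsometry.toContinuousLinearMap ∘L T₂) fun k => by
        simp [hVe, hT₂, operatorShift_single, hx₂, lp.single_smul]
    exact DFunLike.congr_fun h y

theorem exists_shift_moments {α β : ℕ × ℕ → ℝ} (hα : ∀ k, 0 < α k) (hβ : ∀ k, 0 < β k)
    (hcomm : ∀ k : ℕ × ℕ, β (k.1 + 1, k.2) * α k = α (k.1, k.2 + 1) * β k) :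
    ∃ g : ℕ × ℕ → ℝ, g (0, 0) = 1 ∧ (∀ k, 0 < g k) ∧
      (∀ k, g (k.1 + 1, k.2) = α k * g k) ∧ ∀ k, g (k.1, k.2 + 1) = β k * g k := by
  refine ⟨fun k => (∏ i ∈ Finset.range k.1, α (i, 0)) * ∏ j ∈ Finset.range k.2, β (k.1, j),
    by simp, fun k => mul_pos (Finset.prod_pos fun _ _ => hα _) (Finset.prod_pos fun _ _ => hβ _),
    fun ⟨i, j⟩ => ?_, fun ⟨i, j⟩ => ?_⟩
  · simp only
    induction j with
    | zero => simp [Finset.prod_range_succ, mul_comm]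
    | succ j ih =>
      have h := hcomm (i, j)
      simp only at h
      rw [Finset.prod_range_succ _ j, Finset.prod_range_succ _ j, ← mul_assoc, ih]
      linear_combination
        ((∏ i ∈ Finset.range i, α (i, 0)) * ∏ j ∈ Finset.range j, β (i, j)) * h
  · simp only
    rw [Finset.prod_range_succ]
    ring

theorem pow_apply_e2_fst {α g : ℕ × ℕ → ℝ} {T₁ : H2 →L[ℂ] H2}
    (hT₁ : ∀ k : ℕ × ℕ, T₁ (e2 k) = (α k : ℂ) • e2 (k.1 + 1, k.2))
    (hgα : ∀ k, g (k.1 + 1, k.2) = α k * g k) (k l : ℕ) :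
    (T₁ ^ k) ((g (0, l) : ℂ) • e2 (0, l)) = (g (k, l) : ℂ) • e2 (k, l) := by
  induction k with
  | zero => rfl
  | succ k ih =>
    rw [pow_succ', mul_apply_eq_comp, ih, map_smul, hT₁, smul_smul, hgα (k, l)]
    push_cast
    rw [mul_comm]

theorem pow_apply_e2_snd {β g : ℕ × ℕ → ℝ} {T₂ : H2 →L[ℂ] H2}
    (hT₂ : ∀ k : ℕ × ℕ, T₂ (e2 k) = (β k : ℂ) • e2 (k.1, k.2 + 1))
    (hgβ : ∀ k, g (k.1, k.2 + 1) = β k * g k) (k l : ℕ) :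
    (T₂ ^ l) ((g (k, 0) : ℂ) • e2 (k, 0)) = (g (k, l) : ℂ) • e2 (k, l) := by
  induction l with
  | zero => rfl
  | succ l ih =>
    rw [pow_succ', mul_apply_eq_comp, ih, map_smul, hT₂, smul_smul, hgβ (k, l)]
    push_cast
    rw [mul_comm]

theorem norm_smul_e2 {r : ℝ} (hr : 0 < r) (k : ℕ × ℕ) : ‖(r : ℂ) • e2 k‖ = r := by
  rw [norm_smul, e2, lp.norm_single (by simp), norm_one, mul_one,
    Complex.norm_of_nonneg hr.le]

/-- For commuting 2-variable weighted shifts with subnormal components, subnormality of one power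
implies subnormality of the pair. -/
theorem isSubnormalPair_of_pow {α β : ℕ × ℕ → ℝ}
    (hα : ∀ k, 0 < α k) (hβ : ∀ k, 0 < β k) {T₁ T₂ : H2 →L[ℂ] H2}
    (hT₁ : ∀ k : ℕ × ℕ, T₁ (e2 k) = (α k : ℂ) • e2 (k.1 + 1, k.2))
    (hT₂ : ∀ k : ℕ × ℕ, T₂ (e2 k) = (β k : ℂ) • e2 (k.1, k.2 + 1))
    (hcomm : ∀ k : ℕ × ℕ, β (k.1 + 1, k.2) * α k = α (k.1, k.2 + 1) * β k)
    (hsub₁ : IsSubnormalOp T₁) (hsub₂ : IsSubnormalOp T₂) {m n : ℕ} (hm : m ≠ 0) (hn : n ≠ 0)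
    (h : IsSubnormalPair (T₁ ^ m) (T₂ ^ n)) : IsSubnormalPair T₁ T₂ := by
  obtain ⟨g, hg0, hg, hgα, hgβ⟩ := exists_shift_moments hα hβ hcomm
  obtain ⟨K, _, _, _, V, P₁, P₂, hP₁, hP₂, hP, hnorm⟩ := h.exists_norm_pow_eq hm hn
  obtain ⟨K₁, _, _, _, V₁, C₁, hC₁, hnorm₁⟩ := hsub₁.exists_norm_pow_eq
  obtain ⟨K₂, _, _, _, V₂, C₂, hC₂, hnorm₂⟩ := hsub₂.exists_norm_pow_eq
  set v : K := V (e2 (0, 0))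
  have hmn : ∀ k l, ‖(P₁ ^ (m * k)) ((P₂ ^ (n * l)) v)‖ = g (m * k, n * l) := fun k l => by
    have h₂ := pow_apply_e2_snd hT₂ hgβ 0 (n * l)
    rw [hg0, Complex.ofReal_one, one_smul] at h₂
    rw [hnorm, h₂, pow_apply_e2_fst hT₁ hgα, norm_smul_e2 (hg _)]
  have hrow : ∀ k l, ‖(P₁ ^ k) ((P₂ ^ (n * l)) v)‖ = g (k, n * l) := fun k l => by
    rw [norm_pow_apply_eq_of_norm_pow_mul_apply_eq hP₁ hC₁ hm
      (u := V₁ ((g (0, n * l) : ℂ) • e2 (0, n * l))) _ k, hnorm₁, pow_apply_e2_fst hT₁ hgα,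
      norm_smul_e2 (hg _)]
    intro j
    rw [hmn, hnorm₁, pow_apply_e2_fst hT₁ hgα, norm_smul_e2 (hg _)]
  have hc : ∀ k l, (P₁ ^ k) ((P₂ ^ l) v) = (P₂ ^ l) ((P₁ ^ k) v) := fun k l =>
    DFunLike.congr_fun (hP.pow_pow k l).eq v
  refine isSubnormalPair_of_norm_pow_eq hT₁ hT₂ hg hgα hgβ hP₁ hP₂ hP (v := v) fun ⟨k, l⟩ => ?_
  rw [hc, norm_pow_apply_eq_of_norm_pow_mul_apply_eq hP₂ hC₂ hn
    (u := V₂ ((g (k, 0) : ℂ) • e2 (k, 0))) _ l, hnorm₂, pow_apply_e2_snd hT₂ hgβ,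
    norm_smul_e2 (hg _)]
  intro j
  rw [← hc, hrow, hnorm₂, pow_apply_e2_snd hT₂ hgβ, norm_smul_e2 (hg _)]

end WeightedShift

/-- Theorem 5.1 (Main Theorem): for a commuting 2-variable weighted shift in the class
`TC` (subnormal components, core of tensor form), subnormality of the pair, of all of its
powers, and of some power are all equivalent. -/
theorem subnormal_iff_all_powers_iff_some_power
    (α β : ℕ × ℕ → ℝ)
    (hαpos : ∀ k, 0 < α k) (hβpos : ∀ k, 0 < β k)
    (hαbdd : ∃ C : ℝ, ∀ k, α k ≤ C) (hβbdd : ∃ C : ℝ, ∀ k, β k ≤ C)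
    (T₁ T₂ : H2 →L[ℂ] H2)
    (hT₁ : ∀ k : ℕ × ℕ, T₁ (e2 k) = (α k : ℂ) • e2 (k.1 + 1, k.2))
    (hT₂ : ∀ k : ℕ × ℕ, T₂ (e2 k) = (β k : ℂ) • e2 (k.1, k.2 + 1))
    (hcomm : ∀ k : ℕ × ℕ, β (k.1 + 1, k.2) * α k = α (k.1, k.2 + 1) * β k)
    (hsub₁ : IsSubnormalOp T₁) (hsub₂ : IsSubnormalOp T₂)
    (hcore₁ : ∀ k₁ k₂ k₂' : ℕ, 1 ≤ k₁ → 1 ≤ k₂ → 1 ≤ k₂' → α (k₁, k₂) = α (k₁, k₂'))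
    (hcore₂ : ∀ k₁ k₁' k₂ : ℕ, 1 ≤ k₁ → 1 ≤ k₁' → 1 ≤ k₂ → β (k₁, k₂) = β (k₁', k₂)) :
    List.TFAE [IsSubnormalPair T₁ T₂,
      ∀ m n : ℕ, 1 ≤ m → 1 ≤ n → IsSubnormalPair (T₁ ^ m) (T₂ ^ n),
      ∃ m n : ℕ, 1 ≤ m ∧ 1 ≤ n ∧ IsSubnormalPair (T₁ ^ m) (T₂ ^ n)] := by
  tfae_have 1 → 2 := fun h m n _ _ => h.pow m n
  tfae_have 2 → 3 := fun h => ⟨1, 1, le_rfl, le_rfl, h 1 1 le_rfl le_rfl⟩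
  tfae_have 3 → 1 := fun ⟨m, n, hm, hn, h⟩ =>
    isSubnormalPair_of_pow hαpos hβpos hT₁ hT₂ hcomm hsub₁ hsub₂
      (Nat.one_le_iff_ne_zero.mp hm) (Nat.one_le_iff_ne_zero.mp hn) h
  tfae_finish

end
end

section
/- Let T = (T₁,T₂) be a commuting 2-variable weighted shift in the class TC, and let n ≥ 2 be an integer. If (T₁, T₂ⁿ) is a subnormal pair, then (T₁,T₂) is a subnormal pair. -/
open MeasureTheory
open scoped ENNReal

noncomputable section

namespace WeightedShift

theorem re_inner_real_smul_left {K : Type*} [NormedAddCommGroup K] [InnerProductSpace ℂ K]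
    (a : ℝ) (u v : K) : (inner ℂ (a • u) v).re = a * (inner ℂ u v).re := by
  rw [← Complex.coe_smul, inner_smul_left]
  simp

theorem re_inner_aeval_eq {K K' : Type*} [NormedAddCommGroup K] [InnerProductSpace ℂ K]
    [NormedAddCommGroup K'] [InnerProductSpace ℂ K'] {P : K →L[ℂ] K} {Q : K' →L[ℂ] K'}
    {y : K} {z : K'}
    (h : ∀ j : ℕ, (inner ℂ ((P ^ j) y) y).re = (inner ℂ ((Q ^ j) z) z).re)
    (p : Polynomial ℝ) :
    (inner ℂ ((Polynomial.aeval P p) y) y).re = (inner ℂ ((Polynomial.aeval Q p) z) z).re := by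
  induction p using Polynomial.induction_on' with
  | add p q hp hq => simp [hp, hq]
  | monomial j a =>
    simp only [Polynomial.aeval_monomial, ← Algebra.smul_def, smul_apply,
      re_inner_real_smul_left, h]

section Moments

variable {K K' : Type*} [NormedAddCommGroup K] [InnerProductSpace ℂ K] [CompleteSpace K]
  [NormedAddCommGroup K'] [InnerProductSpace ℂ K'] [CompleteSpace K']

theorem exists_root_of_nonneg (P : K →L[ℂ] K) (hP : 0 ≤ P) (m : ℕ) (hm : m ≠ 0) :
    ∃ B : K →L[ℂ] K, 0 ≤ B ∧ B ^ m = P ∧ ∀ c, Commute P c → Commute B c := by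
  have hP' : IsSelfAdjoint P := IsSelfAdjoint.of_nonneg hP
  refine ⟨cfc (fun x : ℝ => x ^ ((m : ℝ)⁻¹)) P, ?_, ?_, fun c hc => hc.cfc_real _⟩
  · exact cfc_nonneg fun x hx => Real.rpow_nonneg (spectrum_nonneg_of_nonneg hP hx) _
  · have hcont : ContinuousOn (fun x : ℝ => x ^ ((m : ℝ)⁻¹)) (spectrum ℝ P) :=
      (Real.continuous_rpow_const (by positivity)).continuousOn
    rw [← cfc_pow _ m P hcont]
    conv_rhs => rw [← cfc_id ℝ P]
    exact cfc_congr fun x hx =>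
      Real.rpow_inv_natCast_pow (spectrum_nonneg_of_nonneg hP hx) hm

theorem norm_pow_apply_eq {A N : K →L[ℂ] K} (hA : IsSelfAdjoint A) (hN : IsStarNormal N)
    (h : A ^ 2 = star N * N) (i : ℕ) (x : K) : ‖(A ^ i) x‖ = ‖(N ^ i) x‖ := by
  have key : star (A ^ i) * A ^ i = star (N ^ i) * N ^ i := by
    rw [star_pow, star_pow, hA.star_eq, ← pow_add, ← two_mul, pow_mul, h,
      hN.star_comm_self.mul_pow]
  have hsq (C : K →L[ℂ] K) : ‖C x‖ ^ 2 = RCLike.re (inner ℂ ((star C * C) x) x) := by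
    rw [ContinuousLinearMap.star_eq_adjoint]
    exact C.apply_norm_sq_eq_inner_adjoint_left x
  rw [← sq_eq_sq₀ (norm_nonneg _) (norm_nonneg _), hsq, hsq, key]

theorem abs_re_inner_cfc_sub_le {P : K →L[ℂ] K} (hP : 0 ≤ P) {M ε : ℝ} (hM : ‖P‖ ≤ M)
    (hε : 0 ≤ ε) {f : ℝ → ℝ} (hf : Continuous f) {p : Polynomial ℝ}
    (hp : ∀ x ∈ Set.Icc 0 M, |p.eval x - f x| < ε) (y : K) :
    |(inner ℂ ((Polynomial.aeval P p) y) y).re - (inner ℂ ((cfc f P) y) y).re|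
      ≤ ε * ‖y‖ ^ 2 := by
  have hP' : IsSelfAdjoint P := IsSelfAdjoint.of_nonneg hP
  have hpc : ContinuousOn p.eval (spectrum ℝ P) := p.continuous.continuousOn
  have hnorm : ‖Polynomial.aeval P p - cfc f P‖ ≤ ε := by
    rw [← cfc_polynomial p P, ← cfc_sub _ _ P hpc hf.continuousOn]
    refine norm_cfc_le hε fun x hx => (hp x ⟨spectrum_nonneg_of_nonneg hP hx, ?_⟩).le
    rcases subsingleton_or_nontrivial (K →L[ℂ] K) with hs | hs
    · simp [spectrum.of_subsingleton] at hx
    · exact ((le_abs_self x).trans (spectrum.norm_le_norm_of_mem hx)).trans hM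
  rw [← Complex.sub_re, ← inner_sub_left, ← sub_apply]
  calc _ ≤ ‖inner ℂ ((Polynomial.aeval P p - cfc f P) y) y‖ := Complex.abs_re_le_norm _
    _ ≤ ‖(Polynomial.aeval P p - cfc f P) y‖ * ‖y‖ := norm_inner_le_norm _ _
    _ ≤ (ε * ‖y‖) * ‖y‖ := by
      gcongr
      exact ContinuousLinearMap.le_of_opNorm_le _ hnorm y
    _ = ε * ‖y‖ ^ 2 := by ring

/-- The moments of a positive operator at a vector determine its continuous functional calculus
at that vector. -/
theorem re_inner_cfc_eq {P : K →L[ℂ] K} {Q : K' →L[ℂ] K'} (hP : 0 ≤ P) (hQ : 0 ≤ Q)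
    {y : K} {z : K'}
    (h : ∀ j : ℕ, (inner ℂ ((P ^ j) y) y).re = (inner ℂ ((Q ^ j) z) z).re)
    {f : ℝ → ℝ} (hf : Continuous f) :
    (inner ℂ ((cfc f P) y) y).re = (inner ℂ ((cfc f Q) z) z).re := by
  refine eq_of_abs_sub_nonpos ?_
  refine le_of_forall_pos_le_add fun δ hδ => ?_
  set C := ‖y‖ ^ 2 + ‖z‖ ^ 2 + 1
  have hC : 0 < C := by positivity
  obtain ⟨p, hp⟩ := exists_polynomial_near_of_continuousOn 0 (max ‖P‖ ‖Q‖) f hf.continuousOn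
    (δ / C) (by positivity)
  have h1 := abs_re_inner_cfc_sub_le hP (le_max_left _ _) (by positivity) hf hp y
  have h2 := abs_re_inner_cfc_sub_le hQ (le_max_right _ _) (by positivity) hf hp z
  rw [re_inner_aeval_eq h p] at h1
  have h3 : δ / C * C = δ := div_mul_cancel₀ _ hC.ne'
  have h4 : 0 < δ / C := by positivity
  have h5 : δ / C * C = δ / C * ‖y‖ ^ 2 + δ / C * ‖z‖ ^ 2 + δ / C := by ring
  rw [abs_le] at h1 h2 ⊢
  constructor <;> linarith

theorem norm_pow_apply_sq {C : K →L[ℂ] K} (hC : IsSelfAdjoint C) (i : ℕ) (u : K) :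
    ‖(C ^ i) u‖ ^ 2 = (inner ℂ ((C ^ (2 * i)) u) u).re := by
  rw [two_mul, pow_add]
  nth_rw 2 [← (hC.pow i).star_eq]
  rw [ContinuousLinearMap.star_eq_adjoint]
  exact (C ^ i).apply_norm_sq_eq_inner_adjoint_left u

theorem cfc_rpow_inv_pow {C : K →L[ℂ] K} (hC : 0 ≤ C) {n : ℕ} (hn : n ≠ 0) (j : ℕ) :
    cfc (fun x : ℝ => (x ^ ((n : ℝ)⁻¹)) ^ j) (C ^ (2 * n)) = C ^ (2 * j) := by
  have hC' : IsSelfAdjoint C := IsSelfAdjoint.of_nonneg hC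
  have hcont : Continuous (fun x : ℝ => (x ^ ((n : ℝ)⁻¹)) ^ j) :=
    (Real.continuous_rpow_const (by positivity)).pow j
  rw [← cfc_comp_pow _ _ C hcont.continuousOn, ← cfc_pow_id (R := ℝ) C (2 * j)]
  refine cfc_congr fun x hx => ?_
  have hx0 : 0 ≤ x := spectrum_nonneg_of_nonneg hC hx
  simp only [pow_mul x 2]
  rw [Real.pow_rpow_inv_natCast (by positivity) hn]

theorem norm_pow_apply_eq_of_norm_pow_mul_eq {B : K →L[ℂ] K} {S : K' →L[ℂ] K'} (hB : 0 ≤ B)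
    (hS : 0 ≤ S) {y : K} {z : K'} {n : ℕ} (hn : n ≠ 0)
    (h : ∀ j : ℕ, ‖(B ^ (n * j)) y‖ = ‖(S ^ (n * j)) z‖) (j : ℕ) :
    ‖(B ^ j) y‖ = ‖(S ^ j) z‖ := by
  have hB' : IsSelfAdjoint B := IsSelfAdjoint.of_nonneg hB
  have hS' : IsSelfAdjoint S := IsSelfAdjoint.of_nonneg hS
  have hmom := re_inner_cfc_eq (CStarAlgebra.pow_nonneg hB (2 * n))
    (CStarAlgebra.pow_nonneg hS (2 * n)) (y := y) (z := z)
    (f := fun x : ℝ => (x ^ ((n : ℝ)⁻¹)) ^ j)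
    (fun i => by
      rw [← pow_mul, ← pow_mul, mul_assoc, ← norm_pow_apply_sq hB', ← norm_pow_apply_sq hS', h])
    ((Real.continuous_rpow_const (inv_nonneg.2 n.cast_nonneg)).pow j)
  rw [cfc_rpow_inv_pow hB hn, cfc_rpow_inv_pow hS hn, ← norm_pow_apply_sq hB',
    ← norm_pow_apply_sq hS'] at hmom
  exact (sq_eq_sq₀ (norm_nonneg _) (norm_nonneg _)).1 hmom

end Moments

section OperatorShift

variable {G K : Type*} [AddCommGroup G] [NormedAddCommGroup K] [InnerProductSpace ℂ K]

/-- The operator `A ⊗ U^g` on `ℓ²(G, K)`, where `U^g` is translation by `g`. -/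
def operatorShift (A : K →L[ℂ] K) (g : G) :
    lp (fun _ : G => K) 2 →L[ℂ] lp (fun _ : G => K) 2 :=
  have hb (f : lp (fun _ : G => K) 2) :
      Summable fun k => (‖A‖ * ‖f (k - g)‖) ^ 2 := by
    have h := (lp.memℓp f).summable (by simp)
    simp only [ENNReal.toReal_ofNat, Real.rpow_ofNat] at h
    simp only [mul_pow]
    exact (((Equiv.subRight g).summable_iff (f := fun k => ‖f k‖ ^ 2)).2 h).mul_left _
  have hle (f : lp (fun _ : G => K) 2) (k : G) :
      ‖A (f (k - g))‖ ^ 2 ≤ (‖A‖ * ‖f (k - g)‖) ^ 2 := by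
    gcongr
    exact A.le_opNorm _
  have hs (f : lp (fun _ : G => K) 2) : Summable fun k => ‖A (f (k - g))‖ ^ 2 :=
    (hb f).of_nonneg_of_le (fun _ => by positivity) (hle f)
  LinearMap.mkContinuous
    { toFun := fun f => ⟨fun k => A (f (k - g)), memℓp_gen (by simpa using hs f)⟩
      map_add' := fun f f' => by ext k; exact A.map_add _ _
      map_smul' := fun c f => by ext k; exact A.map_smul _ _ }
    ‖A‖
    (fun f => by
      rw [← sq_le_sq₀ (norm_nonneg _) (by positivity)]
      have h2 (f : lp (fun _ : G => K) 2) : ‖f‖ ^ 2 = ∑' k, ‖f k‖ ^ 2 := by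
        have := lp.norm_rpow_eq_tsum (p := 2) (by simp) f
        simpa using this
      rw [h2, mul_pow, h2, ← (Equiv.subRight g).tsum_eq (fun k => ‖f k‖ ^ 2), ← tsum_mul_left]
      refine (hs f).tsum_le_tsum (fun k => (hle f k).trans_eq (mul_pow _ _ _)) ?_
      simpa only [mul_pow, Equiv.subRight_apply] using hb f)

@[simp]
theorem operatorShift_apply (A : K →L[ℂ] K) (g : G) (f : lp (fun _ : G => K) 2) (k : G) :
    operatorShift A g f k = A (f (k - g)) :=
  rfl

theorem operatorShift_mul (A B : K →L[ℂ] K) (g h : G) :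
    operatorShift A g * operatorShift B h = operatorShift (A * B) (g + h) := by
  ext f k
  simp [sub_sub]

theorem operatorShift_single [DecidableEq G] (A : K →L[ℂ] K) (g k : G) (x : K) :
    operatorShift A g (lp.single 2 k x) = lp.single 2 (k + g) (A x) := by
  ext l
  simp only [operatorShift_apply, lp.single_apply, Pi.single_apply, sub_eq_iff_eq_add]
  split_ifs <;> simp

theorem star_operatorShift [CompleteSpace K] (A : K →L[ℂ] K) (g : G) :
    star (operatorShift A g) = operatorShift (star A) (-g) := by
  rw [ContinuousLinearMap.star_eq_adjoint]
  refine ((ContinuousLinearMap.eq_adjoint_iff _ _).2 fun f f' => ?_).symm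
  simp only [lp.inner_eq_tsum, operatorShift_apply, ContinuousLinearMap.star_eq_adjoint,
    ContinuousLinearMap.adjoint_inner_left, sub_neg_eq_add]
  rw [← (Equiv.subRight g).tsum_eq]
  simp

theorem isStarNormal_operatorShift [CompleteSpace K] {A : K →L[ℂ] K} (hA : IsStarNormal A)
    (g : G) : IsStarNormal (operatorShift A g) := by
  refine ⟨?_⟩
  rw [star_operatorShift, Commute, SemiconjBy, operatorShift_mul, operatorShift_mul,
    hA.star_comm_self.eq, add_comm]

end OperatorShift

theorem e2_ext {E : Type*} [NormedAddCommGroup E] [InnerProductSpace ℂ E] {F F' : H2 →L[ℂ] E}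
    (h : ∀ k, F (e2 k) = F' (e2 k)) : F = F' := by
  ext x
  have hx := lp.hasSum_single (p := 2) (by simp) x
  have hs (k : ℕ × ℕ) : (lp.single 2 k (x k) : H2) = x k • e2 k := by
    rw [e2, ← lp.single_smul, smul_eq_mul, mul_one]
  refine (hx.mapL F).unique ?_
  convert! hx.mapL F' using 2 with k
  rw [hs, map_smul, map_smul, h]

theorem norm_e2 (k : ℕ × ℕ) : ‖e2 k‖ = 1 := by
  rw [e2, lp.norm_single (by simp), norm_one]

/-- The norm of `T₂ʲ T₁ⁱ e₀` for the weighted shift with weights `α`, `β`. -/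
def weight (α β : ℕ × ℕ → ℝ) (k : ℕ × ℕ) : ℝ :=
  (∏ a ∈ Finset.range k.1, α (a, 0)) * ∏ b ∈ Finset.range k.2, β (k.1, b)

section Weights

variable {α β : ℕ × ℕ → ℝ}

theorem weight_pos (hα : ∀ k, 0 < α k) (hβ : ∀ k, 0 < β k) (k : ℕ × ℕ) : 0 < weight α β k :=
  mul_pos (Finset.prod_pos fun _ _ => hα _) (Finset.prod_pos fun _ _ => hβ _)

theorem weight_succ_right (i j : ℕ) : weight α β (i, j + 1) = β (i, j) * weight α β (i, j) := by
  simp only [weight, Finset.prod_range_succ]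
  ring

theorem weight_succ_left
    (hcomm : ∀ k : ℕ × ℕ, β (k.1 + 1, k.2) * α k = α (k.1, k.2 + 1) * β k) (i j : ℕ) :
    weight α β (i + 1, j) = α (i, j) * weight α β (i, j) := by
  induction j with
  | zero =>
    simp only [weight, Finset.prod_range_succ, Finset.prod_range_zero]
    ring
  | succ j ih =>
    rw [weight_succ_right, ih, weight_succ_right, ← mul_assoc, ← mul_assoc, hcomm (i, j)]

theorem pow_apply_e2_zero {T₁ T₂ : H2 →L[ℂ] H2}
    (hT₁ : ∀ k : ℕ × ℕ, T₁ (e2 k) = (α k : ℂ) • e2 (k.1 + 1, k.2))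
    (hT₂ : ∀ k : ℕ × ℕ, T₂ (e2 k) = (β k : ℂ) • e2 (k.1, k.2 + 1)) (i j : ℕ) :
    (T₂ ^ j) ((T₁ ^ i) (e2 (0, 0))) = (weight α β (i, j) : ℂ) • e2 (i, j) := by
  induction j with
  | zero =>
    induction i with
    | zero => simp [weight]
    | succ i ih =>
      simp only [pow_zero, one_apply_eq_self] at ih ⊢
      rw [pow_succ', mul_apply_eq_comp, ih, map_smul, hT₁, smul_smul]
      simp [weight, Finset.prod_range_succ]
  | succ j ih =>
    rw [pow_succ', mul_apply_eq_comp, ih, map_smul, hT₂, smul_smul,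
      weight_succ_right]
    push_cast
    rw [mul_comm]

theorem norm_pow_apply_e2_zero (hα : ∀ k, 0 < α k) (hβ : ∀ k, 0 < β k) {T₁ T₂ : H2 →L[ℂ] H2}
    (hT₁ : ∀ k : ℕ × ℕ, T₁ (e2 k) = (α k : ℂ) • e2 (k.1 + 1, k.2))
    (hT₂ : ∀ k : ℕ × ℕ, T₂ (e2 k) = (β k : ℂ) • e2 (k.1, k.2 + 1)) (i j : ℕ) :
    ‖(T₂ ^ j) ((T₁ ^ i) (e2 (0, 0)))‖ = weight α β (i, j) := by
  rw [pow_apply_e2_zero hT₁ hT₂, norm_smul, norm_e2, mul_one, Complex.norm_real,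
    Real.norm_of_nonneg (weight_pos hα hβ _).le]

end Weights

theorem pow_extension_apply {H K : Type*} [NormedAddCommGroup H] [InnerProductSpace ℂ H]
    [NormedAddCommGroup K] [InnerProductSpace ℂ K] {V : H →ₗᵢ[ℂ] K} {N : K →L[ℂ] K}
    {S : H →L[ℂ] H} (h : ∀ x, N (V x) = V (S x)) (i : ℕ) (x : H) :
    (N ^ i) (V x) = V ((S ^ i) x) := by
  induction i generalizing x with
  | zero => simp
  | succ i ih => rw [pow_succ, pow_succ, mul_apply_eq_comp, h, ih]; rfl

/-- A commuting 2-variable weighted shift is a subnormal pair as soon as its moments are the joint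
moments of a pair of commuting self-adjoint operators at some vector. -/
theorem isSubnormalPair_of_moments {α β : ℕ × ℕ → ℝ} (hα : ∀ k, 0 < α k) (hβ : ∀ k, 0 < β k)
    {T₁ T₂ : H2 →L[ℂ] H2}
    (hT₁ : ∀ k : ℕ × ℕ, T₁ (e2 k) = (α k : ℂ) • e2 (k.1 + 1, k.2))
    (hT₂ : ∀ k : ℕ × ℕ, T₂ (e2 k) = (β k : ℂ) • e2 (k.1, k.2 + 1))
    (hcomm : ∀ k : ℕ × ℕ, β (k.1 + 1, k.2) * α k = α (k.1, k.2 + 1) * β k)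
    {K : Type} [NormedAddCommGroup K] [InnerProductSpace ℂ K] [CompleteSpace K]
    {A B : K →L[ℂ] K} (hA : IsSelfAdjoint A) (hB : IsSelfAdjoint B) (hAB : Commute A B) (x : K)
    (hx : ∀ i j : ℕ, ‖(B ^ j) ((A ^ i) x)‖ = weight α β (i, j)) :
    IsSubnormalPair T₁ T₂ := by
  let pos : ℕ × ℕ → ℤ × ℤ := fun k => (k.1, k.2)
  have hpos : Function.Injective pos := fun k l h => by
    simpa [pos, Prod.ext_iff] using h
  let u : ℕ × ℕ → K := fun k => ((weight α β k : ℂ)⁻¹) • (B ^ k.2) ((A ^ k.1) x)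
  let v : ℕ × ℕ → lp (fun _ : ℤ × ℤ => K) 2 := fun k => lp.single 2 (pos k) (u k)
  have hw (k : ℕ × ℕ) : (weight α β k : ℂ) ≠ 0 :=
    Complex.ofReal_ne_zero.2 (weight_pos hα hβ k).ne'
  have hu (k : ℕ × ℕ) : ‖u k‖ = 1 := by
    simp only [u]
    rw [norm_smul, hx, norm_inv, Complex.norm_real,
      Real.norm_of_nonneg (weight_pos hα hβ k).le, inv_mul_cancel₀ (weight_pos hα hβ k).ne']
  have hv : Orthonormal ℂ v := by
    refine ⟨fun k => ?_, fun k l hkl => ?_⟩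
    · simp only [v]
      rw [lp.norm_single (by simp), hu]
    · simp only [v]
      rw [lp.inner_single_left, lp.single_apply_ne _ _ _ (fun h => hkl (hpos h)), inner_zero_right]
  let V := hv.orthogonalFamily.linearIsometry
  have hV (k : ℕ × ℕ) : V (e2 k) = v k := by
    simp only [V, e2]
    rw [OrthogonalFamily.linearIsometry_apply_single]
    simp
  have hAu (k : ℕ × ℕ) : A (u k) = (α k : ℂ) • u (k.1 + 1, k.2) := by
    have h0 : A ((B ^ k.2) ((A ^ k.1) x)) = (B ^ k.2) ((A ^ (k.1 + 1)) x) := by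
      rw [pow_succ', ← mul_apply_eq_comp, (hAB.pow_right k.2).eq]
      rfl
    simp only [u]
    rw [map_smul, h0, smul_smul, weight_succ_left hcomm, Complex.ofReal_mul, mul_inv,
      mul_inv_cancel_left₀ (Complex.ofReal_ne_zero.2 (hα k).ne')]
  have hBu (k : ℕ × ℕ) : B (u k) = (β k : ℂ) • u (k.1, k.2 + 1) := by
    have h0 : B ((B ^ k.2) ((A ^ k.1) x)) = (B ^ (k.2 + 1)) ((A ^ k.1) x) := by
      rw [pow_succ']
      rfl
    simp only [u]
    rw [map_smul, h0, smul_smul, weight_succ_right, Complex.ofReal_mul, mul_inv,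
      mul_inv_cancel_left₀ (Complex.ofReal_ne_zero.2 (hβ k).ne')]
  refine ⟨lp (fun _ : ℤ × ℤ => K) 2, inferInstance, inferInstance, inferInstance, V,
    operatorShift A (1, 0), operatorShift B (0, 1),
    isStarNormal_operatorShift hA.isStarNormal _, isStarNormal_operatorShift hB.isStarNormal _,
    ?_, ?_, ?_⟩
  · rw [operatorShift_mul, operatorShift_mul, hAB.eq, add_comm]
  · refine fun y => congrArg (fun F : H2 →L[ℂ] _ => F y) (e2_ext
      (F := (operatorShift A (1, 0)).comp V.toContinuousLinearMap)
      (F' := V.toContinuousLinearMap.comp T₁) fun k => ?_)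
    simp only [ContinuousLinearMap.comp_apply, LinearIsometry.coe_toContinuousLinearMap]
    rw [hT₁, map_smul, hV, hV, operatorShift_single, hAu, lp.single_smul]
    simp [v, pos]
  · refine fun y => congrArg (fun F : H2 →L[ℂ] _ => F y) (e2_ext
      (F := (operatorShift B (0, 1)).comp V.toContinuousLinearMap)
      (F' := V.toContinuousLinearMap.comp T₂) fun k => ?_)
    simp only [ContinuousLinearMap.comp_apply, LinearIsometry.coe_toContinuousLinearMap]
    rw [hT₂, map_smul, hV, hV, operatorShift_single, hBu, lp.single_smul]
    simp [v, pos]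

end WeightedShift

/-- Corollary: if `(T₁, T₂ⁿ)` is a subnormal pair for some `n ≥ 2`, where `(T₁,T₂)` is a
commuting 2-variable weighted shift in the class `TC`, then `(T₁,T₂)` is a subnormal pair. -/
theorem subnormal_of_power_two_subnormal
    (α β : ℕ × ℕ → ℝ)
    (hαpos : ∀ k, 0 < α k) (hβpos : ∀ k, 0 < β k)
    (hαbdd : ∃ C : ℝ, ∀ k, α k ≤ C) (hβbdd : ∃ C : ℝ, ∀ k, β k ≤ C)
    (T₁ T₂ : H2 →L[ℂ] H2)
    (hT₁ : ∀ k : ℕ × ℕ, T₁ (e2 k) = (α k : ℂ) • e2 (k.1 + 1, k.2))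
    (hT₂ : ∀ k : ℕ × ℕ, T₂ (e2 k) = (β k : ℂ) • e2 (k.1, k.2 + 1))
    (hcomm : ∀ k : ℕ × ℕ, β (k.1 + 1, k.2) * α k = α (k.1, k.2 + 1) * β k)
    (hsub₁ : IsSubnormalOp T₁) (hsub₂ : IsSubnormalOp T₂)
    (hcore₁ : ∀ k₁ k₂ k₂' : ℕ, 1 ≤ k₁ → 1 ≤ k₂ → 1 ≤ k₂' → α (k₁, k₂) = α (k₁, k₂'))
    (hcore₂ : ∀ k₁ k₁' k₂ : ℕ, 1 ≤ k₁ → 1 ≤ k₁' → 1 ≤ k₂ → β (k₁, k₂) = β (k₁', k₂))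
    (n : ℕ) (hn : 2 ≤ n)
    (hpow : IsSubnormalPair T₁ (T₂ ^ n)) :
    IsSubnormalPair T₁ T₂ := by
  obtain ⟨K, _, _, _, V, N, M, hN, hM, hNM, hVN, hVM⟩ := hpow
  obtain ⟨K', _, _, _, V', L, hL, hVL⟩ := hsub₂
  have hNM' : Commute N (star M * M) :=
    (hM.commute_star_right hNM).mul_right hNM
  obtain ⟨A, hA, hA2, hAc⟩ :=
    WeightedShift.exists_root_of_nonneg (star N * N) (star_mul_self_nonneg N) 2 two_ne_zero
  obtain ⟨B, hB, hB2, hBc⟩ :=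
    WeightedShift.exists_root_of_nonneg (star M * M) (star_mul_self_nonneg M) (n * 2) (by omega)
  obtain ⟨S, hS, hS2, -⟩ :=
    WeightedShift.exists_root_of_nonneg (star L * L) (star_mul_self_nonneg L) 2 two_ne_zero
  have hBN : Commute B N := hBc N hNM'.symm
  have hA' : IsSelfAdjoint A := IsSelfAdjoint.of_nonneg hA
  have hB' : IsSelfAdjoint B := IsSelfAdjoint.of_nonneg hB
  have hAB : Commute A B := by
    refine hAc B (Commute.mul_left ?_ hBN.symm)
    simpa [hB'.star_eq] using hBN.symm.star_star
  refine WeightedShift.isSubnormalPair_of_moments hαpos hβpos hT₁ hT₂ hcomm hA' hB' hAB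
    (V (e2 (0, 0))) fun i j => ?_
  have hSL (j : ℕ) :
      ‖(S ^ j) (V' ((T₁ ^ i) (e2 (0, 0))))‖ = WeightedShift.weight α β (i, j) := by
    rw [WeightedShift.norm_pow_apply_eq (IsSelfAdjoint.of_nonneg hS) hL hS2,
      WeightedShift.pow_extension_apply hVL, V'.norm_map,
      WeightedShift.norm_pow_apply_e2_zero hαpos hβpos hT₁ hT₂]
  rw [← hSL j]
  refine WeightedShift.norm_pow_apply_eq_of_norm_pow_mul_eq hB hS (by omega : n ≠ 0)
    (fun l => ?_) j
  have hswap {C D : K →L[ℂ] K} (h : Commute C D) (w : K) : C (D w) = D (C w) :=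
    DFunLike.congr_fun h.eq w
  rw [hSL, hswap (hAB.symm.pow_pow _ _), WeightedShift.norm_pow_apply_eq hA' hN hA2,
    ← hswap (hBN.pow_pow _ _), pow_mul,
    WeightedShift.norm_pow_apply_eq (hB'.pow n) hM (by rw [← pow_mul, hB2]),
    WeightedShift.pow_extension_apply hVN, WeightedShift.pow_extension_apply hVM, V.norm_map,
    ← pow_mul, WeightedShift.norm_pow_apply_e2_zero hαpos hβpos hT₁ hT₂]

end
end

section
/- Let T = (T₁,T₂) be a commuting 2-variable weighted shift in the class TC, and let m ≥ 2 be an integer. If (T₁ᵐ, T₂) is a subnormal pair, then (T₁,T₂) is a subnormal pair. -/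
open MeasureTheory
open scoped ENNReal

noncomputable section

section FunctionalCalculus

variable {E F : Type*} [NormedAddCommGroup E] [InnerProductSpace ℂ E]
  [NormedAddCommGroup F] [InnerProductSpace ℂ F]

open Polynomial in
theorem inner_aeval_eq_of_inner_pow_eq {X : E →L[ℂ] E} {Y : F →L[ℂ] F} {x : E} {y : F}
    (h : ∀ n : ℕ, inner ℂ x ((X ^ n) x) = inner ℂ y ((Y ^ n) y)) (p : ℝ[X]) :
    inner ℂ x (aeval X p x) = inner ℂ y (aeval Y p y) := by
  induction p using Polynomial.induction_on' with
  | add p q hp hq => simp [hp, hq]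
  | monomial n a =>
    simp only [aeval_monomial, ← Algebra.smul_def, _root_.smul_apply,
      inner_smul_right_eq_smul, h]

variable [CompleteSpace E] [CompleteSpace F]

theorem norm_inner_cfc_sub_le {X : E →L[ℂ] E} (hX : IsSelfAdjoint X) (x : E) {φ : ℝ → ℝ}
    (hφ : Continuous φ) {p : Polynomial ℝ} {ε : ℝ} (hε : 0 ≤ ε)
    (hp : ∀ t ∈ spectrum ℝ X, |p.eval t - φ t| ≤ ε) :
    ‖inner ℂ x (Polynomial.aeval X p x) - inner ℂ x (cfc φ X x)‖ ≤ ε * ‖x‖ ^ 2 := by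
  have hle : ‖Polynomial.aeval X p - cfc φ X‖ ≤ ε := by
    rw [← cfc_polynomial p X, ← cfc_sub _ _ X p.continuous.continuousOn hφ.continuousOn]
    exact norm_cfc_le hε hp
  calc ‖inner ℂ x (Polynomial.aeval X p x) - inner ℂ x (cfc φ X x)‖
      = ‖inner ℂ x ((Polynomial.aeval X p - cfc φ X) x)‖ := by simp
    _ ≤ ‖x‖ * (ε * ‖x‖) := (norm_inner_le_norm _ _).trans <| by
        gcongr
        exact ContinuousLinearMap.le_of_opNorm_le _ hle x
    _ = ε * ‖x‖ ^ 2 := by ring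

/-- A compactly supported moment sequence is determinate: two vectors with the same power moments
have the same moments with respect to every continuous function. -/
theorem inner_cfc_eq_of_inner_pow_eq {X : E →L[ℂ] E} {Y : F →L[ℂ] F}
    (hX : IsSelfAdjoint X) (hY : IsSelfAdjoint Y) {x : E} {y : F}
    (h : ∀ n : ℕ, inner ℂ x ((X ^ n) x) = inner ℂ y ((Y ^ n) y))
    {φ : ℝ → ℝ} (hφ : Continuous φ) :
    inner ℂ x (cfc φ X x) = inner ℂ y (cfc φ Y y) := by
  obtain ⟨C, hC⟩ := ((spectrum.isCompact (𝕜 := ℝ) X).union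
    (spectrum.isCompact (𝕜 := ℝ) Y)).isBounded.subset_closedBall 0
  rw [Real.closedBall_eq_Icc, Set.union_subset_iff] at hC
  refine eq_of_forall_dist_le fun δ hδ ↦ ?_
  set c : ℝ := ‖x‖ ^ 2 + ‖y‖ ^ 2 + 1 with hc
  have hc0 : 0 < c := by positivity
  have hε : 0 < δ / c := by positivity
  obtain ⟨p, hp⟩ := exists_polynomial_near_of_continuousOn _ _ φ hφ.continuousOn (δ / c) hε
  have h₁ := norm_inner_cfc_sub_le hX x hφ hε.le fun t ht ↦ (hp t (hC.1 ht)).le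
  have h₂ := norm_inner_cfc_sub_le hY y hφ hε.le fun t ht ↦ (hp t (hC.2 ht)).le
  rw [inner_aeval_eq_of_inner_pow_eq h p] at h₁
  rw [← dist_eq_norm] at h₁ h₂
  calc _ ≤ δ / c * ‖x‖ ^ 2 + δ / c * ‖y‖ ^ 2 :=
        (dist_triangle_left _ _ _).trans (add_le_add h₁ h₂)
    _ ≤ δ / c * c := by rw [hc]; nlinarith
    _ = δ := by field_simp

theorem inner_star_mul_self_pow {N : E →L[ℂ] E} (hN : IsStarNormal N) (n : ℕ) (x : E) :
    inner ℂ x (((star N * N) ^ n) x) = (‖(N ^ n) x‖ : ℂ) ^ 2 := by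
  rw [hN.star_comm_self.mul_pow, ← star_pow, ContinuousLinearMap.star_eq_adjoint,
    mul_apply_eq_comp, ContinuousLinearMap.adjoint_inner_right,
    inner_self_eq_norm_sq_to_K]
  rfl

/-- The positive `2m`-th root of `N⋆N`, i.e. the positive `m`-th root of the modulus of `N`. -/
def modulusRoot (m : ℕ) (N : E →L[ℂ] E) : E →L[ℂ] E :=
  cfc (fun t : ℝ ↦ |t| ^ ((2 * m : ℝ)⁻¹)) (star N * N)

theorem continuous_abs_rpow_root (m : ℕ) : Continuous fun t : ℝ ↦ |t| ^ ((2 * m : ℝ)⁻¹) :=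
  continuous_abs.rpow_const fun _ ↦ .inr (by positivity)

theorem isSelfAdjoint_modulusRoot (m : ℕ) (N : E →L[ℂ] E) : IsSelfAdjoint (modulusRoot m N) :=
  cfc_predicate _ _

theorem norm_modulusRoot_pow_sq (m : ℕ) (N : E →L[ℂ] E) (k : ℕ) (x : E) :
    (‖(modulusRoot m N ^ k) x‖ : ℂ) ^ 2 =
      inner ℂ x (cfc (fun t : ℝ ↦ (|t| ^ ((2 * m : ℝ)⁻¹)) ^ (2 * k)) (star N * N) x) := by
  have hA := isSelfAdjoint_modulusRoot m N
  rw [cfc_pow _ _ _ (continuous_abs_rpow_root m).continuousOn (.star_mul_self N),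
    ← modulusRoot, mul_comm, pow_mul', sq (modulusRoot m N)]
  have := inner_star_mul_self_pow hA.isStarNormal k x
  rw [hA.star_eq] at this
  rw [this]

theorem cfc_root_star_mul_self_pow {m : ℕ} (hm : m ≠ 0) (k : ℕ) (M : E →L[ℂ] E) :
    cfc (fun t : ℝ ↦ (|t| ^ ((2 * m : ℝ)⁻¹)) ^ (2 * k)) ((star M * M) ^ m) =
      (star M * M) ^ k := by
  rw [← cfc_comp_pow (fun t : ℝ ↦ (|t| ^ ((2 * m : ℝ)⁻¹)) ^ (2 * k)) m (star M * M) ((continuous_abs_rpow_root m).pow _).continuousOn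
    (.star_mul_self M), ← cfc_pow_id (R := ℝ) (star M * M) k (.star_mul_self M)]
  refine cfc_congr fun t ht ↦ ?_
  have ht : 0 ≤ t := spectrum_nonneg_of_nonneg (star_mul_self_nonneg M) ht
  have hm' : (m : ℝ) ≠ 0 := by exact_mod_cast hm
  simp only [abs_of_nonneg (pow_nonneg ht m)]
  rw [← Real.rpow_natCast t m, ← Real.rpow_mul ht, ← Real.rpow_natCast _ (2 * k),
    ← Real.rpow_mul ht, ← Real.rpow_natCast t k]
  congr 1
  push_cast
  field_simp

/-- If the powers of `M ^ m` and of `N` have the same effect on norms at `y` and `x`, then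
so do the powers of `M` and of the `m`-th root of the modulus of `N`. -/
theorem norm_modulusRoot_pow_eq {m : ℕ} (hm : m ≠ 0) {N : E →L[ℂ] E} {M : F →L[ℂ] F}
    (hN : IsStarNormal N) (hM : IsStarNormal M) {x : E} {y : F}
    (h : ∀ n : ℕ, ‖(N ^ n) x‖ = ‖(M ^ (m * n)) y‖) (k : ℕ) :
    ‖(modulusRoot m N ^ k) x‖ = ‖(M ^ k) y‖ := by
  have key : (‖(modulusRoot m N ^ k) x‖ : ℂ) ^ 2 = (‖(M ^ k) y‖ : ℂ) ^ 2 := by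
    rw [norm_modulusRoot_pow_sq, ← inner_star_mul_self_pow hM,
      ← cfc_root_star_mul_self_pow hm k M]
    refine inner_cfc_eq_of_inner_pow_eq (.star_mul_self N) ((IsSelfAdjoint.star_mul_self M).pow m)
      (fun n ↦ ?_) ((continuous_abs_rpow_root m).pow _)
    rw [← pow_mul, inner_star_mul_self_pow hN, inner_star_mul_self_pow hM, h]
  exact (sq_eq_sq₀ (norm_nonneg _) (norm_nonneg _)).1 (by exact_mod_cast key)

end FunctionalCalculus

section OperatorShift

variable {ι K : Type*} [NormedAddCommGroup K] [InnerProductSpace ℂ K]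

/-- The operator on `ℓ²(ι; K)` that applies `S` in every coordinate and permutes the coordinates
by `σ`. -/
def permShift (σ : Equiv.Perm ι) (S : K →L[ℂ] K) :
    lp (fun _ : ι ↦ K) 2 →L[ℂ] lp (fun _ : ι ↦ K) 2 :=
  LinearIsometry.toContinuousLinearMap
    { toFun := fun x ↦ ⟨fun i ↦ x (σ.symm i), by
        have := (lp.memℓp x).summable (by simp)
        exact memℓp_gen ((σ.symm.summable_iff).2 this)⟩
      map_add' := fun _ _ ↦ rfl
      map_smul' := fun _ _ ↦ rfl
      norm_map' := fun x ↦ by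
        rw [lp.norm_eq_tsum_rpow (by simp), lp.norm_eq_tsum_rpow (by simp)]
        congr 1
        exact σ.symm.tsum_eq fun i ↦ ‖x i‖ ^ (2 : ℝ≥0∞).toReal } ∘L
  lp.mapCLM 2 (fun _ ↦ S) (norm_nonneg S) fun _ ↦ le_rfl

theorem permShift_apply (σ : Equiv.Perm ι) (S : K →L[ℂ] K) (x : lp (fun _ : ι ↦ K) 2) (i : ι) :
    permShift σ S x i = S (x (σ.symm i)) := rfl

theorem permShift_mul (σ τ : Equiv.Perm ι) (S R : K →L[ℂ] K) :
    permShift σ S * permShift τ R = permShift (σ * τ) (S * R) := rfl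

theorem permShift_single [DecidableEq ι] (σ : Equiv.Perm ι) (S : K →L[ℂ] K) (i : ι) (v : K) :
    permShift σ S (lp.single 2 i v) = lp.single 2 (σ i) (S v) := by
  ext j
  rw [permShift_apply, lp.single_apply, lp.single_apply]
  by_cases h : j = σ i
  · subst h; simp
  · rw [Pi.single_eq_of_ne h, Pi.single_eq_of_ne (fun h' ↦ h (by simp [← h'])), map_zero]

variable [CompleteSpace K]

theorem star_permShift (σ : Equiv.Perm ι) (S : K →L[ℂ] K) :
    star (permShift σ S) = permShift σ⁻¹ (star S) := by
  rw [ContinuousLinearMap.star_eq_adjoint, eq_comm, ContinuousLinearMap.eq_adjoint_iff]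
  intro x y
  rw [lp.inner_eq_tsum, lp.inner_eq_tsum, ← σ.symm.tsum_eq]
  refine tsum_congr fun i ↦ ?_
  simp [permShift_apply, ContinuousLinearMap.star_eq_adjoint,
    ContinuousLinearMap.adjoint_inner_left, Equiv.Perm.inv_def]

theorem isStarNormal_permShift (σ : Equiv.Perm ι) {S : K →L[ℂ] K} (hS : IsStarNormal S) :
    IsStarNormal (permShift σ S) := by
  refine ⟨?_⟩
  rw [star_permShift, Commute, SemiconjBy, permShift_mul, permShift_mul, hS.star_comm_self.eq,
    inv_mul_cancel, mul_inv_cancel]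

end OperatorShift

theorem H2.clm_ext {E : Type*} [NormedAddCommGroup E] [NormedSpace ℂ E] {f g : H2 →L[ℂ] E}
    (h : ∀ k, f (e2 k) = g (e2 k)) : f = g :=
  lp.ext_continuousLinearMap (by simp) fun k ↦ ContinuousLinearMap.ext_ring (h k)

theorem norm_e2 (k : ℕ × ℕ) : ‖e2 k‖ = 1 := by
  simp [e2, lp.norm_single]

section WeightedShift

variable {α β : ℕ × ℕ → ℝ} {T₁ T₂ : H2 →L[ℂ] H2}

theorem weightedShift_commute
    (hT₁ : ∀ k : ℕ × ℕ, T₁ (e2 k) = (α k : ℂ) • e2 (k.1 + 1, k.2))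
    (hT₂ : ∀ k : ℕ × ℕ, T₂ (e2 k) = (β k : ℂ) • e2 (k.1, k.2 + 1))
    (hcomm : ∀ k : ℕ × ℕ, β (k.1 + 1, k.2) * α k = α (k.1, k.2 + 1) * β k) :
    Commute T₁ T₂ := by
  refine H2.clm_ext fun k ↦ ?_
  simp only [mul_apply_eq_comp, hT₁, hT₂, map_smul, smul_smul]
  congr 1
  rw [mul_comm, mul_comm (α k : ℂ)]
  exact_mod_cast (hcomm k).symm

theorem weightedShift_pow_apply
    (hαpos : ∀ k, 0 < α k) (hβpos : ∀ k, 0 < β k)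
    (hT₁ : ∀ k : ℕ × ℕ, T₁ (e2 k) = (α k : ℂ) • e2 (k.1 + 1, k.2))
    (hT₂ : ∀ k : ℕ × ℕ, T₂ (e2 k) = (β k : ℂ) • e2 (k.1, k.2 + 1)) (i j : ℕ) :
    ∃ d : ℝ, 0 < d ∧ (T₁ ^ i) ((T₂ ^ j) (e2 0)) = (d : ℂ) • e2 (i, j) := by
  induction i with
  | zero =>
    induction j with
    | zero => exact ⟨1, one_pos, by simp; rfl⟩
    | succ j ih =>
      obtain ⟨d, hd, h⟩ := ih
      refine ⟨d * β (0, j), mul_pos hd (hβpos _), ?_⟩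
      simp only [pow_zero, one_apply_eq_self] at h ⊢
      rw [pow_succ', mul_apply_eq_comp, h, map_smul, hT₂, smul_smul]
      push_cast
      rfl
  | succ i ih =>
    obtain ⟨d, hd, h⟩ := ih
    refine ⟨d * α (i, j), mul_pos hd (hαpos _), ?_⟩
    rw [pow_succ', mul_apply_eq_comp, h, map_smul, hT₁, smul_smul]
    push_cast
    rfl

theorem weightedShift_pow_apply_eq_norm_smul
    (hαpos : ∀ k, 0 < α k) (hβpos : ∀ k, 0 < β k)
    (hT₁ : ∀ k : ℕ × ℕ, T₁ (e2 k) = (α k : ℂ) • e2 (k.1 + 1, k.2))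
    (hT₂ : ∀ k : ℕ × ℕ, T₂ (e2 k) = (β k : ℂ) • e2 (k.1, k.2 + 1)) (k : ℕ × ℕ) :
    0 < ‖(T₁ ^ k.1) ((T₂ ^ k.2) (e2 0))‖ ∧
      (T₁ ^ k.1) ((T₂ ^ k.2) (e2 0)) = (‖(T₁ ^ k.1) ((T₂ ^ k.2) (e2 0))‖ : ℂ) • e2 k := by
  obtain ⟨d, hd, h⟩ := weightedShift_pow_apply hαpos hβpos hT₁ hT₂ k.1 k.2
  have hn : ‖(T₁ ^ k.1) ((T₂ ^ k.2) (e2 0))‖ = d := by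
    rw [h, norm_smul, norm_e2, mul_one, Complex.norm_real, Real.norm_of_nonneg hd.le]
  rw [hn]
  exact ⟨hd, h⟩

/-- A commuting 2-variable weighted shift is a subnormal pair if the norms of the vectors
`T₁ⁱ T₂ʲ e₀` are those of `Aⁱ Nʲ f` for commuting normal operators `A`, `N`. -/
theorem isSubnormalPair_of_norm_eq
    (hαpos : ∀ k, 0 < α k) (hβpos : ∀ k, 0 < β k)
    (hT₁ : ∀ k : ℕ × ℕ, T₁ (e2 k) = (α k : ℂ) • e2 (k.1 + 1, k.2))
    (hT₂ : ∀ k : ℕ × ℕ, T₂ (e2 k) = (β k : ℂ) • e2 (k.1, k.2 + 1))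
    (hcomm : Commute T₁ T₂)
    {K : Type} [NormedAddCommGroup K] [InnerProductSpace ℂ K] [CompleteSpace K]
    {A N : K →L[ℂ] K} (hA : IsStarNormal A) (hN : IsStarNormal N) (hAN : Commute A N) (f : K)
    (hnorm : ∀ i j : ℕ, ‖(A ^ i) ((N ^ j) f)‖ = ‖(T₁ ^ i) ((T₂ ^ j) (e2 0))‖) :
    IsSubnormalPair T₁ T₂ := by
  classical
  set d : ℕ × ℕ → ℝ := fun k ↦ ‖(T₁ ^ k.1) ((T₂ ^ k.2) (e2 0))‖ with hd
  have hd0 (k) : 0 < d k := (weightedShift_pow_apply_eq_norm_smul hαpos hβpos hT₁ hT₂ k).1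
  have hde (k) : (T₁ ^ k.1) ((T₂ ^ k.2) (e2 0)) = (d k : ℂ) • e2 k :=
    (weightedShift_pow_apply_eq_norm_smul hαpos hβpos hT₁ hT₂ k).2
  have hdα (k : ℕ × ℕ) : d (k.1 + 1, k.2) = d k * α k := by
    rw [hd]
    simp only
    rw [pow_succ', mul_apply_eq_comp, hde, map_smul, hT₁, norm_smul, norm_smul,
      norm_smul, norm_e2, norm_e2, mul_one, mul_one, Complex.norm_real, Complex.norm_real,
      Real.norm_of_nonneg (hd0 k).le, Real.norm_of_nonneg (hαpos k).le]
  have hdβ (k : ℕ × ℕ) : d (k.1, k.2 + 1) = d k * β k := by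
    rw [hd]
    simp only
    rw [pow_succ', ← mul_apply_eq_comp, ← mul_assoc, (hcomm.pow_left k.1).eq,
      mul_assoc, mul_apply_eq_comp, mul_apply_eq_comp, hde, map_smul, hT₂,
      norm_smul, norm_smul, norm_smul, norm_e2, norm_e2, mul_one, mul_one, Complex.norm_real,
      Complex.norm_real, Real.norm_of_nonneg (hd0 k).le, Real.norm_of_nonneg (hβpos k).le]
  let c : ℕ × ℕ → ℤ × ℤ := fun k ↦ (k.1, k.2)
  let v : ℕ × ℕ → lp (fun _ : ℤ × ℤ ↦ K) 2 := fun k ↦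
    ((d k)⁻¹ : ℂ) • lp.single 2 (c k) ((A ^ k.1) ((N ^ k.2) f))
  have hv : Orthonormal ℂ v := by
    refine ⟨fun k ↦ ?_, fun k l hkl ↦ ?_⟩
    · have : ‖(A ^ k.1) ((N ^ k.2) f)‖ = d k := hnorm _ _
      rw [norm_smul, lp.norm_single (by simp), this, norm_inv, Complex.norm_real,
        Real.norm_of_nonneg (hd0 k).le, inv_mul_cancel₀ (hd0 k).ne']
    · have hc : c k ≠ c l := fun h ↦ hkl <| by
        simpa [c, Prod.ext_iff] using h
      simp only [v]
      rw [inner_smul_left, inner_smul_right, lp.inner_single_left, lp.single_apply,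
        Pi.single_eq_of_ne hc]
      simp
  have hV (k) : hv.orthogonalFamily.linearIsometry (e2 k) = v k := by
    rw [e2, OrthogonalFamily.linearIsometry_apply_single]
    simp
  refine ⟨lp (fun _ : ℤ × ℤ ↦ K) 2, inferInstance, inferInstance, inferInstance,
    hv.orthogonalFamily.linearIsometry, permShift (Equiv.addRight ((1, 0) : ℤ × ℤ)) A,
    permShift (Equiv.addRight ((0, 1) : ℤ × ℤ)) N, isStarNormal_permShift _ hA, isStarNormal_permShift _ hN,
    ?_, ?_, ?_⟩
  · rw [permShift_mul, permShift_mul, hAN.eq]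
    congr 1
    ext x <;> simp
  · refine fun x ↦ DFunLike.congr_fun (H2.clm_ext
      (f := permShift (Equiv.addRight ((1, 0) : ℤ × ℤ)) A ∘L
        hv.orthogonalFamily.linearIsometry.toContinuousLinearMap)
      (g := hv.orthogonalFamily.linearIsometry.toContinuousLinearMap ∘L T₁) fun k ↦ ?_) x
    have hc : Equiv.addRight ((1, 0) : ℤ × ℤ) (c k) = c (k.1 + 1, k.2) := by simp [c]
    have hd' : (d k : ℂ) ≠ 0 := by exact_mod_cast (hd0 k).ne'
    have hα' : (α k : ℂ) ≠ 0 := by exact_mod_cast (hαpos k).ne'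
    simp only [ContinuousLinearMap.comp_apply, LinearIsometry.coe_toContinuousLinearMap, hT₁,
      map_smul, hV]
    simp only [v, map_smul, permShift_single, hc, smul_smul, hdα, pow_succ' A,
      mul_apply_eq_comp]
    congr 1
    push_cast
    field_simp
  · refine fun x ↦ DFunLike.congr_fun (H2.clm_ext
      (f := permShift (Equiv.addRight ((0, 1) : ℤ × ℤ)) N ∘L
        hv.orthogonalFamily.linearIsometry.toContinuousLinearMap)
      (g := hv.orthogonalFamily.linearIsometry.toContinuousLinearMap ∘L T₂) fun k ↦ ?_) x
    have hc : Equiv.addRight ((0, 1) : ℤ × ℤ) (c k) = c (k.1, k.2 + 1) := by simp [c]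
    have hd' : (d k : ℂ) ≠ 0 := by exact_mod_cast (hd0 k).ne'
    have hβ' : (β k : ℂ) ≠ 0 := by exact_mod_cast (hβpos k).ne'
    have hmove : N ((A ^ k.1) ((N ^ k.2) f)) = (A ^ k.1) ((N ^ (k.2 + 1)) f) := by
      rw [pow_succ', mul_apply_eq_comp, ← mul_apply_eq_comp,
        ← (hAN.pow_left k.1).eq, mul_apply_eq_comp]
    simp only [ContinuousLinearMap.comp_apply, LinearIsometry.coe_toContinuousLinearMap, hT₂,
      map_smul, hV]
    simp only [v, map_smul, permShift_single, hc, smul_smul, hdβ, hmove]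
    congr 1
    push_cast
    field_simp

end WeightedShift

theorem intertwine_pow {H K : Type*} [NormedAddCommGroup H] [InnerProductSpace ℂ H]
    [NormedAddCommGroup K] [InnerProductSpace ℂ K] {V : H →ₗᵢ[ℂ] K} {N : K →L[ℂ] K}
    {S : H →L[ℂ] H} (h : ∀ x, N (V x) = V (S x)) (n : ℕ) (x : H) :
    (N ^ n) (V x) = V ((S ^ n) x) := by
  induction n with
  | zero => simp
  | succ n ih =>
    rw [pow_succ', pow_succ', mul_apply_eq_comp, mul_apply_eq_comp, ih, h]

/-- Corollary: if `(T₁ᵐ, T₂)` is a subnormal pair for some `m ≥ 2`, where `(T₁,T₂)` is a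
commuting 2-variable weighted shift in the class `TC`, then `(T₁,T₂)` is a subnormal pair. -/
theorem subnormal_of_power_one_subnormal
    (α β : ℕ × ℕ → ℝ)
    (hαpos : ∀ k, 0 < α k) (hβpos : ∀ k, 0 < β k)
    (hαbdd : ∃ C : ℝ, ∀ k, α k ≤ C) (hβbdd : ∃ C : ℝ, ∀ k, β k ≤ C)
    (T₁ T₂ : H2 →L[ℂ] H2)
    (hT₁ : ∀ k : ℕ × ℕ, T₁ (e2 k) = (α k : ℂ) • e2 (k.1 + 1, k.2))
    (hT₂ : ∀ k : ℕ × ℕ, T₂ (e2 k) = (β k : ℂ) • e2 (k.1, k.2 + 1))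
    (hcomm : ∀ k : ℕ × ℕ, β (k.1 + 1, k.2) * α k = α (k.1, k.2 + 1) * β k)
    (hsub₁ : IsSubnormalOp T₁) (hsub₂ : IsSubnormalOp T₂)
    (hcore₁ : ∀ k₁ k₂ k₂' : ℕ, 1 ≤ k₁ → 1 ≤ k₂ → 1 ≤ k₂' → α (k₁, k₂) = α (k₁, k₂'))
    (hcore₂ : ∀ k₁ k₁' k₂ : ℕ, 1 ≤ k₁ → 1 ≤ k₁' → 1 ≤ k₂ → β (k₁, k₂) = β (k₁', k₂))
    (m : ℕ) (hm : 2 ≤ m)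
    (hpow : IsSubnormalPair (T₁ ^ m) T₂) :
    IsSubnormalPair T₁ T₂ := by
  obtain ⟨K, _, _, _, V, N₁, N₂, hN₁, hN₂, hN, hV₁, hV₂⟩ := hpow
  obtain ⟨L, _, _, _, W, M, hM, hW⟩ := hsub₁
  have hroot : Commute (modulusRoot m N₁) N₂ :=
    ((hN₁.commute_star_left hN).mul_left hN).cfc_real _
  refine isSubnormalPair_of_norm_eq hαpos hβpos hT₁ hT₂ (weightedShift_commute hT₁ hT₂ hcomm)
    (isSelfAdjoint_modulusRoot m N₁).isStarNormal hN₂ hroot (V (e2 0)) fun i j ↦ ?_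
  rw [intertwine_pow hV₂, ← W.norm_map, ← intertwine_pow hW]
  refine norm_modulusRoot_pow_eq (by omega) hN₁ hM (fun n ↦ ?_) i
  rw [intertwine_pow hV₁, intertwine_pow hW, V.norm_map, W.norm_map, pow_mul]

end
end

section
/- Let T = (T₁,T₂) be a commuting 2-variable weighted shift in the class TC and let m,n ≥ 1. For 0 ≤ p ≤ m−1 and 0 ≤ q ≤ n−1, let H_{(p,q)} be the closed span of {e_{(mℓ+p, nk+q)} : ℓ,k ≥ 0}, and let U_{(p,q)} : ℓ²(ℤ₊²) → H_{(p,q)} be the unitary determined by e_{(ℓ,k)} ↦ e_{(mℓ+p, nk+q)}. Then H_{(p,q)} is invariant under T₁ᵐ, T₂ⁿ and their adjoints, and the pair (U_{(p,q)}* T₁ᵐ U_{(p,q)}, U_{(p,q)}* T₂ⁿ U_{(p,q)}) is a commuting 2-variable weighted shift belonging to TC (i.e., it has subnormal components and its core is of tensor form). Consequently T^{(m,n)} = (T₁ᵐ,T₂ⁿ) is an orthogonal direct sum of 2-variable weighted shifts in TC. -/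
open MeasureTheory
open scoped ENNReal

noncomputable section

/-- The subspace `H_{(p,q)}^{(m,n)}`: the closed span of `{e_{(mℓ+p, nk+q)} : ℓ,k ≥ 0}`. -/
noncomputable def Hsub (m n p q : ℕ) : Submodule ℂ H2 :=
  (Submodule.span ℂ
    (Set.range fun lk : ℕ × ℕ => e2 (m * lk.1 + p, n * lk.2 + q))).topologicalClosure

theorem inner_e2_left (k : ℕ × ℕ) (x : H2) : @inner ℂ H2 _ (e2 k) x = x k := by
  simp [e2, lp.inner_single_left]

theorem e2_apply (k i : ℕ × ℕ) : (e2 k : H2) i = if i = k then 1 else 0 := by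
  simp [e2, Pi.single_apply]

theorem hasSum_smul_e2 (x : H2) : HasSum (fun i => x i • e2 i) x := by
  have h := lp.hasSum_single (E := fun _ : ℕ × ℕ => ℂ) (p := 2) (by norm_num) x
  refine h.congr_fun fun i => ?_
  rw [e2, ← lp.single_smul, smul_eq_mul, mul_one]

theorem clm_ext_e2 {F : Type*} [NormedAddCommGroup F] [NormedSpace ℂ F] {A B : H2 →L[ℂ] F}
    (h : ∀ k, A (e2 k) = B (e2 k)) : A = B := by
  ext x
  have hA := (hasSum_smul_e2 x).mapL A
  have hB := (hasSum_smul_e2 x).mapL B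
  simp only [map_smul, h] at hA hB
  exact hA.unique hB

theorem smul_e2_injective (k : ℕ × ℕ) {a b : ℝ} (h : (a : ℂ) • e2 k = (b : ℂ) • e2 k) :
    a = b := by
  have hne : e2 k ≠ 0 := fun h0 => by simpa [h0] using e2_apply k k
  exact Complex.ofReal_injective (smul_left_injective ℂ hne h)

theorem mem_closure_span_e2_iff {s : Set (ℕ × ℕ)} {x : H2} :
    x ∈ (Submodule.span ℂ (e2 '' s)).topologicalClosure ↔ ∀ i ∉ s, x i = 0 := by
  constructor
  · intro hx i hi
    have hle : (Submodule.span ℂ (e2 '' s)).topologicalClosure ≤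
        (innerSL ℂ (e2 i) : H2 →L[ℂ] ℂ).ker := by
      refine Submodule.topologicalClosure_minimal _ (Submodule.span_le.2 ?_)
        (ContinuousLinearMap.isClosed_ker _)
      rintro _ ⟨k, hk, rfl⟩
      have hik : i ≠ k := fun h => hi (h ▸ hk)
      simp [inner_e2_left, e2_apply, hik]
    simpa [inner_e2_left] using hle hx
  · intro h
    refine (Submodule.isClosed_topologicalClosure _).mem_of_tendsto (hasSum_smul_e2 x)
      (Filter.Eventually.of_forall fun t => Submodule.sum_mem _ fun i _ => ?_)
    by_cases hi : i ∈ s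
    · exact Submodule.smul_mem _ _
        (Submodule.le_topologicalClosure _ (Submodule.subset_span ⟨i, hi, rfl⟩))
    · simp [h i hi]

theorem mem_range_index_iff {m n p q : ℕ} (hp : p < m) (hq : q < n) (i : ℕ × ℕ) :
    i ∈ Set.range (fun lk : ℕ × ℕ => (m * lk.1 + p, n * lk.2 + q)) ↔
      i.1 % m = p ∧ i.2 % n = q := by
  constructor
  · rintro ⟨lk, rfl⟩
    simp [Nat.mod_eq_of_lt hp, Nat.mod_eq_of_lt hq]
  · rintro ⟨rfl, rfl⟩
    exact ⟨(i.1 / m, i.2 / n), by simp [Nat.div_add_mod]⟩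

theorem mem_Hsub_iff {m n p q : ℕ} (hp : p < m) (hq : q < n) {x : H2} :
    x ∈ Hsub m n p q ↔ ∀ i : ℕ × ℕ, ¬(i.1 % m = p ∧ i.2 % n = q) → x i = 0 := by
  rw [Hsub, Set.range_comp' e2, mem_closure_span_e2_iff]
  simp only [mem_range_index_iff hp hq]

theorem inner_eq_zero_of_mem_Hsub {m n p q p' q' : ℕ} (hp : p < m) (hq : q < n) (hp' : p' < m)
    (hq' : q' < n) (hne : (p, q) ≠ (p', q')) {x y : H2} (hx : x ∈ Hsub m n p q)
    (hy : y ∈ Hsub m n p' q') : @inner ℂ H2 _ x y = 0 := by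
  rw [mem_Hsub_iff hp hq] at hx
  rw [mem_Hsub_iff hp' hq'] at hy
  rw [lp.inner_eq_tsum, ← tsum_zero (α := ℂ) (β := ℕ × ℕ)]
  congr 1
  ext i
  by_cases h : i.1 % m = p ∧ i.2 % n = q
  · rw [hy i (by grind), inner_zero_right]
  · rw [hx i h, inner_zero_left]

/-- The truncation of a square-summable family to a set of indices. -/
def truncate (s : Set (ℕ × ℕ)) (x : H2) : H2 :=
  ⟨s.indicator x, (lp.memℓp x).mono' fun _ => norm_indicator_le_norm_self _ _⟩

theorem truncate_apply (s : Set (ℕ × ℕ)) (x : H2) (i : ℕ × ℕ) :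
    truncate s x i = s.indicator x i := rfl

theorem iSup_Hsub_eq_top {m n : ℕ} (hm : 1 ≤ m) (hn : 1 ≤ n) :
    (⨆ p : Fin m, ⨆ q : Fin n, Hsub m n p q) = ⊤ := by
  refine Submodule.eq_top_iff'.2 fun x => ?_
  let s (p : Fin m) (q : Fin n) : Set (ℕ × ℕ) := {i | i.1 % m = p ∧ i.2 % n = q}
  have hx : x = ∑ p : Fin m, ∑ q : Fin n, truncate (s p q) x := by
    ext i
    simp only [lp.coeFn_sum, Finset.sum_apply, truncate_apply]
    rw [Finset.sum_eq_single ⟨i.1 % m, Nat.mod_lt _ hm⟩,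
      Finset.sum_eq_single ⟨i.2 % n, Nat.mod_lt _ hn⟩]
    · rw [Set.indicator_of_mem (by simp [s])]
    · intro q _ hq
      exact Set.indicator_of_notMem (fun h => hq (Fin.ext h.2.symm)) _
    · simp
    · intro p _ hp
      exact Finset.sum_eq_zero fun q _ =>
        Set.indicator_of_notMem (fun h => hp (Fin.ext h.1.symm)) _
    · simp
  rw [hx]
  refine Submodule.sum_mem _ fun p _ => Submodule.sum_mem _ fun q _ =>
    Submodule.mem_iSup_of_mem p (Submodule.mem_iSup_of_mem q ?_)
  exact (mem_Hsub_iff p.2 q.2).2 fun i hi => Set.indicator_of_notMem (s := s p q) hi _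

theorem map_mem_Hsub {m n p q : ℕ} (hp : p < m) (hq : q < n) {S : H2 →L[ℂ] H2}
    {w : ℕ × ℕ → ℂ} {f : ℕ × ℕ → ℕ × ℕ} (hS : ∀ k, S (e2 k) = w k • e2 (f k))
    (hf : ∀ k, (f k).1 % m = k.1 % m ∧ (f k).2 % n = k.2 % n) {x : H2}
    (hx : x ∈ Hsub m n p q) : S x ∈ Hsub m n p q := by
  have hle : Hsub m n p q ≤ (Hsub m n p q).comap S.toLinearMap := by
    refine Submodule.topologicalClosure_minimal _ (Submodule.span_le.2 ?_)
      ((Submodule.isClosed_topologicalClosure _).preimage S.continuous)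
    rintro _ ⟨lk, rfl⟩
    refine (mem_Hsub_iff hp hq).2 fun i hi => ?_
    have hne : i ≠ f (m * lk.1 + p, n * lk.2 + q) := by
      rintro rfl
      apply hi
      rw [(hf _).1, (hf _).2]
      exact (mem_range_index_iff hp hq _).1 ⟨lk, rfl⟩
    simp [hS, e2_apply, hne]
  exact hle hx

theorem adjoint_map_mem_Hsub {m n p q : ℕ} (hp : p < m) (hq : q < n) {S : H2 →L[ℂ] H2}
    {w : ℕ × ℕ → ℂ} {f : ℕ × ℕ → ℕ × ℕ} (hS : ∀ k, S (e2 k) = w k • e2 (f k))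
    (hf : ∀ k, (f k).1 % m = k.1 % m ∧ (f k).2 % n = k.2 % n) {x : H2}
    (hx : x ∈ Hsub m n p q) : ContinuousLinearMap.adjoint S x ∈ Hsub m n p q := by
  rw [mem_Hsub_iff hp hq] at hx ⊢
  intro i hi
  rw [← inner_e2_left, ContinuousLinearMap.adjoint_inner_right, hS, inner_smul_left,
    inner_e2_left, hx (f i) (by rwa [(hf i).1, (hf i).2]), mul_zero]

theorem adjoint_comp_self_of_map_e2 {U : H2 →L[ℂ] H2} {σ : ℕ × ℕ → ℕ × ℕ}
    (hσ : Function.Injective σ) (hU : ∀ k, U (e2 k) = e2 (σ k)) :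
    ContinuousLinearMap.adjoint U ∘L U = 1 := by
  refine clm_ext_e2 fun k => ?_
  ext i
  rw [← inner_e2_left, ContinuousLinearMap.comp_apply,
    ContinuousLinearMap.adjoint_inner_right, hU, hU, inner_e2_left]
  simp [e2_apply, hσ.eq_iff]

theorem adjoint_comp_comp_apply_e2 {S U : H2 →L[ℂ] H2} {σ g : ℕ × ℕ → ℕ × ℕ} {w : ℕ × ℕ → ℂ}
    (hσ : Function.Injective σ) (hU : ∀ k, U (e2 k) = e2 (σ k))
    (hS : ∀ k, S (e2 (σ k)) = w k • e2 (σ (g k))) (k : ℕ × ℕ) :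
    (ContinuousLinearMap.adjoint U ∘L S ∘L U) (e2 k) = w k • e2 (g k) := by
  have h := DFunLike.congr_fun (adjoint_comp_self_of_map_e2 hσ hU) (e2 (g k))
  rw [ContinuousLinearMap.comp_apply, hU] at h
  simp [hU, hS, h]

theorem IsSubnormalOp.pow {H : Type} [NormedAddCommGroup H] [InnerProductSpace ℂ H]
    {S : H →L[ℂ] H} (hS : IsSubnormalOp S) (m : ℕ) : IsSubnormalOp (S ^ m) := by
  obtain ⟨K, _, _, _, V, N, hN, h⟩ := hS
  refine ⟨K, _, _, ‹_›, V, N ^ m, ⟨?_⟩, ?_⟩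
  · rw [star_pow]
    exact hN.star_comm_self.pow_pow m m
  · induction m with
    | zero => simp
    | succ m ih =>
      intro x
      rw [pow_succ, pow_succ, mul_apply_eq_comp, mul_apply_eq_comp, h, ih]

theorem IsSubnormalOp.of_intertwining {H H' : Type} [NormedAddCommGroup H]
    [InnerProductSpace ℂ H] [NormedAddCommGroup H'] [InnerProductSpace ℂ H'] {S : H →L[ℂ] H}
    {R : H' →L[ℂ] H'} (hS : IsSubnormalOp S) (U : H' →ₗᵢ[ℂ] H) (hU : ∀ x, S (U x) = U (R x)) :
    IsSubnormalOp R := by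
  obtain ⟨K, _, _, _, V, N, hN, h⟩ := hS
  exact ⟨K, _, _, ‹_›, V.comp U, N, hN, fun x => by simp [h, hU]⟩

theorem IsSubnormalOp.adjoint_comp_comp {S U : H2 →L[ℂ] H2} {σ g : ℕ × ℕ → ℕ × ℕ}
    {w : ℕ × ℕ → ℂ} (hsub : IsSubnormalOp S) (hσ : Function.Injective σ)
    (hU : ∀ k, U (e2 k) = e2 (σ k)) (hS : ∀ k, S (e2 (σ k)) = w k • e2 (σ (g k))) :
    IsSubnormalOp (ContinuousLinearMap.adjoint U ∘L S ∘L U) := by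
  have hnorm := U.norm_map_iff_adjoint_comp_self.2 (adjoint_comp_self_of_map_e2 hσ hU)
  have hint : S ∘L U = U ∘L (ContinuousLinearMap.adjoint U ∘L S ∘L U) := by
    refine clm_ext_e2 fun k => ?_
    rw [ContinuousLinearMap.comp_apply U, adjoint_comp_comp_apply_e2 hσ hU hS]
    simp [hU, hS]
  exact hsub.of_intertwining ⟨U.toLinearMap, hnorm⟩ fun x => DFunLike.congr_fun hint x

theorem pow_apply_e2 {T : H2 →L[ℂ] H2} {w : ℕ × ℕ → ℝ} {f : ℕ × ℕ → ℕ × ℕ}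
    (hT : ∀ k, T (e2 k) = (w k : ℂ) • e2 (f k)) (m : ℕ) (k : ℕ × ℕ) :
    (T ^ m) (e2 k) = ((∏ i ∈ Finset.range m, w (f^[i] k) : ℝ) : ℂ) • e2 (f^[m] k) := by
  induction m with
  | zero => simp
  | succ m ih =>
    rw [pow_succ', mul_apply_eq_comp, ih, map_smul, hT, smul_smul,
      Finset.prod_range_succ, Function.iterate_succ_apply', Complex.ofReal_mul]

theorem iterate_shift_fst (m : ℕ) (k : ℕ × ℕ) :
    (fun k : ℕ × ℕ => (k.1 + 1, k.2))^[m] k = (k.1 + m, k.2) := by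
  induction m with
  | zero => rfl
  | succ m ih => rw [Function.iterate_succ_apply', ih]; rfl

theorem iterate_shift_snd (m : ℕ) (k : ℕ × ℕ) :
    (fun k : ℕ × ℕ => (k.1, k.2 + 1))^[m] k = (k.1, k.2 + m) := by
  induction m with
  | zero => rfl
  | succ m ih => rw [Function.iterate_succ_apply', ih]; rfl

theorem exists_prod_range_le {ι : Type*} {w : ι → ℝ} (hpos : ∀ k, 0 < w k)
    (hbdd : ∃ C : ℝ, ∀ k, w k ≤ C) (m : ℕ) :
    ∃ C : ℝ, ∀ f : ℕ → ι, ∏ i ∈ Finset.range m, w (f i) ≤ C := by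
  obtain ⟨C, hC⟩ := hbdd
  refine ⟨C ^ m, fun f => ?_⟩
  simpa using Finset.prod_le_prod (s := Finset.range m) (fun i _ => (hpos (f i)).le)
    (fun i _ => hC (f i))

/-- Lemma 5.2 (structure of powers): for `T = (T₁,T₂)` in `TC` and `m,n ≥ 1`, each subspace
`H_{(p,q)}` reduces `T₁ᵐ` and `T₂ⁿ`; the subspaces are pairwise orthogonal and span `ℓ²(ℤ₊²)`;
and, conjugating by the unitary `U_{(p,q)} : e_{(ℓ,k)} ↦ e_{(mℓ+p,nk+q)}`, each restricted pair
is again a commuting 2-variable weighted shift belonging to `TC`.  Hence `(T₁ᵐ,T₂ⁿ)` is an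
orthogonal direct sum of 2-variable weighted shifts in `TC`. -/
theorem power_of_TC_is_direct_sum_of_TC
    (α β : ℕ × ℕ → ℝ)
    (hαpos : ∀ k, 0 < α k) (hβpos : ∀ k, 0 < β k)
    (hαbdd : ∃ C : ℝ, ∀ k, α k ≤ C) (hβbdd : ∃ C : ℝ, ∀ k, β k ≤ C)
    (T₁ T₂ : H2 →L[ℂ] H2)
    (hT₁ : ∀ k : ℕ × ℕ, T₁ (e2 k) = (α k : ℂ) • e2 (k.1 + 1, k.2))
    (hT₂ : ∀ k : ℕ × ℕ, T₂ (e2 k) = (β k : ℂ) • e2 (k.1, k.2 + 1))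
    (hcomm : ∀ k : ℕ × ℕ, β (k.1 + 1, k.2) * α k = α (k.1, k.2 + 1) * β k)
    (hsub₁ : IsSubnormalOp T₁) (hsub₂ : IsSubnormalOp T₂)
    (hcore₁ : ∀ k₁ k₂ k₂' : ℕ, 1 ≤ k₁ → 1 ≤ k₂ → 1 ≤ k₂' → α (k₁, k₂) = α (k₁, k₂'))
    (hcore₂ : ∀ k₁ k₁' k₂ : ℕ, 1 ≤ k₁ → 1 ≤ k₁' → 1 ≤ k₂ → β (k₁, k₂) = β (k₁', k₂))
    (m n : ℕ) (hm : 1 ≤ m) (hn : 1 ≤ n) :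
    -- the subspaces H_{(p,q)} fill out ℓ²(ℤ₊²) and are pairwise orthogonal
    ((⨆ p : Fin m, ⨆ q : Fin n, Hsub m n p q) = ⊤) ∧
    (∀ p q p' q' : ℕ, p < m → q < n → p' < m → q' < n → (p, q) ≠ (p', q') →
      ∀ x ∈ Hsub m n p q, ∀ y ∈ Hsub m n p' q', @inner ℂ H2 _ x y = 0) ∧
    -- each H_{(p,q)} reduces T₁ᵐ and T₂ⁿ
    (∀ p q : ℕ, p < m → q < n →
      (∀ x ∈ Hsub m n p q, (T₁ ^ m) x ∈ Hsub m n p q) ∧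
      (∀ x ∈ Hsub m n p q, (T₂ ^ n) x ∈ Hsub m n p q) ∧
      (∀ x ∈ Hsub m n p q, ContinuousLinearMap.adjoint (T₁ ^ m) x ∈ Hsub m n p q) ∧
      (∀ x ∈ Hsub m n p q, ContinuousLinearMap.adjoint (T₂ ^ n) x ∈ Hsub m n p q)) ∧
    -- conjugating by U_{(p,q)}, the restriction of (T₁ᵐ,T₂ⁿ) to H_{(p,q)} is a commuting
    -- 2-variable weighted shift in TC
    (∀ p q : ℕ, p < m → q < n → ∀ U : H2 →L[ℂ] H2,
      (∀ lk : ℕ × ℕ, U (e2 lk) = e2 (m * lk.1 + p, n * lk.2 + q)) →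
      ∃ α' β' : ℕ × ℕ → ℝ,
        (∀ k, 0 < α' k) ∧ (∀ k, 0 < β' k) ∧
        (∃ C : ℝ, ∀ k, α' k ≤ C) ∧ (∃ C : ℝ, ∀ k, β' k ≤ C) ∧
        (∀ k : ℕ × ℕ, (ContinuousLinearMap.adjoint U ∘L (T₁ ^ m) ∘L U) (e2 k) =
          (α' k : ℂ) • e2 (k.1 + 1, k.2)) ∧
        (∀ k : ℕ × ℕ, (ContinuousLinearMap.adjoint U ∘L (T₂ ^ n) ∘L U) (e2 k) =
          (β' k : ℂ) • e2 (k.1, k.2 + 1)) ∧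
        (∀ k : ℕ × ℕ, β' (k.1 + 1, k.2) * α' k = α' (k.1, k.2 + 1) * β' k) ∧
        IsSubnormalOp (ContinuousLinearMap.adjoint U ∘L (T₁ ^ m) ∘L U) ∧
        IsSubnormalOp (ContinuousLinearMap.adjoint U ∘L (T₂ ^ n) ∘L U) ∧
        (∀ k₁ k₂ k₂' : ℕ, 1 ≤ k₁ → 1 ≤ k₂ → 1 ≤ k₂' → α' (k₁, k₂) = α' (k₁, k₂')) ∧
        (∀ k₁ k₁' k₂ : ℕ, 1 ≤ k₁ → 1 ≤ k₁' → 1 ≤ k₂ → β' (k₁, k₂) = β' (k₁', k₂))) := by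
  have hA (k : ℕ × ℕ) : (T₁ ^ m) (e2 k) =
      ((∏ i ∈ Finset.range m, α (k.1 + i, k.2) : ℝ) : ℂ) • e2 (k.1 + m, k.2) := by
    simpa only [iterate_shift_fst] using pow_apply_e2 hT₁ m k
  have hB (k : ℕ × ℕ) : (T₂ ^ n) (e2 k) =
      ((∏ i ∈ Finset.range n, β (k.1, k.2 + i) : ℝ) : ℂ) • e2 (k.1, k.2 + n) := by
    simpa only [iterate_shift_snd] using pow_apply_e2 hT₂ n k
  have hmod₁ (k : ℕ × ℕ) : (k.1 + m, k.2).1 % m = k.1 % m ∧ (k.1 + m, k.2).2 % n = k.2 % n := by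
    simp
  have hmod₂ (k : ℕ × ℕ) : (k.1, k.2 + n).1 % m = k.1 % m ∧ (k.1, k.2 + n).2 % n = k.2 % n := by
    simp
  refine ⟨iSup_Hsub_eq_top hm hn, fun p q p' q' hp hq hp' hq' hne x hx y hy =>
    inner_eq_zero_of_mem_Hsub hp hq hp' hq' hne hx hy, fun p q hp hq =>
    ⟨fun x hx => map_mem_Hsub hp hq hA hmod₁ hx, fun x hx => map_mem_Hsub hp hq hB hmod₂ hx,
      fun x hx => adjoint_map_mem_Hsub hp hq hA hmod₁ hx,
      fun x hx => adjoint_map_mem_Hsub hp hq hB hmod₂ hx⟩, fun p q hp hq U hU => ?_⟩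
  have hcommT : Commute T₁ T₂ := by
    refine clm_ext_e2 fun k => ?_
    simp only [mul_apply_eq_comp, hT₁, hT₂, map_smul, smul_smul]
    rw [← Complex.ofReal_mul, ← Complex.ofReal_mul, mul_comm (β k), ← hcomm, mul_comm (α k)]
  have hcommAB (k : ℕ × ℕ) :
      (∏ i ∈ Finset.range n, β (k.1 + m, k.2 + i)) * ∏ i ∈ Finset.range m, α (k.1 + i, k.2) =
      (∏ i ∈ Finset.range m, α (k.1 + i, k.2 + n)) * ∏ i ∈ Finset.range n, β (k.1, k.2 + i) := by
    have h := DFunLike.congr_fun (hcommT.pow_pow m n).eq (e2 k)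
    simp only [mul_apply_eq_comp, hA, hB, map_smul, smul_smul,
      ← Complex.ofReal_mul] at h
    have h' := smul_e2_injective _ h
    linarith
  have hσ : Function.Injective (fun k : ℕ × ℕ => (m * k.1 + p, n * k.2 + q)) := by
    intro a b h
    simp only [Prod.mk.injEq, Nat.add_right_cancel_iff] at h
    exact Prod.ext (Nat.eq_of_mul_eq_mul_left hm h.1) (Nat.eq_of_mul_eq_mul_left hn h.2)
  have hm_succ (l : ℕ) : m * (l + 1) + p = m * l + p + m := by ring
  have hn_succ (l : ℕ) : n * (l + 1) + q = n * l + q + n := by ring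
  have hAσ (k : ℕ × ℕ) : (T₁ ^ m) (e2 (m * k.1 + p, n * k.2 + q)) =
      ((∏ i ∈ Finset.range m, α (m * k.1 + p + i, n * k.2 + q) : ℝ) : ℂ) •
        e2 (m * (k.1 + 1) + p, n * k.2 + q) := by
    rw [hA, hm_succ]
  have hBσ (k : ℕ × ℕ) : (T₂ ^ n) (e2 (m * k.1 + p, n * k.2 + q)) =
      ((∏ i ∈ Finset.range n, β (m * k.1 + p, n * k.2 + q + i) : ℝ) : ℂ) •
        e2 (m * k.1 + p, n * (k.2 + 1) + q) := by
    rw [hB, hn_succ]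
  have hm_pos {l : ℕ} (hl : 1 ≤ l) : 1 ≤ m * l + p := by nlinarith
  have hn_pos {l : ℕ} (hl : 1 ≤ l) : 1 ≤ n * l + q := by nlinarith
  obtain ⟨C₁, hC₁⟩ := exists_prod_range_le hαpos hαbdd m
  obtain ⟨C₂, hC₂⟩ := exists_prod_range_le hβpos hβbdd n
  refine ⟨fun k => ∏ i ∈ Finset.range m, α (m * k.1 + p + i, n * k.2 + q),
    fun k => ∏ i ∈ Finset.range n, β (m * k.1 + p, n * k.2 + q + i),
    fun k => Finset.prod_pos fun i _ => hαpos _, fun k => Finset.prod_pos fun i _ => hβpos _,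
    ⟨C₁, fun k => hC₁ _⟩, ⟨C₂, fun k => hC₂ _⟩,
    adjoint_comp_comp_apply_e2 (g := fun k => (k.1 + 1, k.2)) hσ hU hAσ,
    adjoint_comp_comp_apply_e2 (g := fun k => (k.1, k.2 + 1)) hσ hU hBσ, fun k => ?_,
    (hsub₁.pow m).adjoint_comp_comp (g := fun k => (k.1 + 1, k.2)) hσ hU hAσ,
    (hsub₂.pow n).adjoint_comp_comp (g := fun k => (k.1, k.2 + 1)) hσ hU hBσ,
    fun k₁ k₂ k₂' h₁ h₂ h₂' => Finset.prod_congr rfl fun i _ =>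
      hcore₁ _ _ _ (le_add_right (hm_pos h₁)) (hn_pos h₂) (hn_pos h₂'),
    fun k₁ k₁' k₂ h₁ h₁' h₂ => Finset.prod_congr rfl fun i _ =>
      hcore₂ _ _ _ (hm_pos h₁) (hm_pos h₁') (le_add_right (hn_pos h₂))⟩
  simpa only [hm_succ, hn_succ] using hcommAB (m * k.1 + p, n * k.2 + q)

end
end

section
/- With the notation of the context (in particular n ≥ 2), the signed measure ψ^{(0,1)} is positive (ψ^{(0,1)}(E) ≥ 0 for every Borel set E) if and only if the signed measure ψ is positive. -/
open MeasureTheory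
open scoped ENNReal

noncomputable section

/-- The `j`-th moment `γ_j(ν) := ∫ t^j dν(t)`. -/
noncomputable def mom (ν : MeasureTheory.Measure ℝ) (j : ℕ) : ℝ := ∫ t, t ^ j ∂ν

/-- The weights `w_j(ν) := (γ_{j+1}(ν)/γ_j(ν))^{1/2}` of the subnormal unilateral weighted
shift whose Berger measure is `ν`. -/
noncomputable def wgt (ν : MeasureTheory.Measure ℝ) (j : ℕ) : ℝ :=
  Real.sqrt (mom ν (j + 1) / mom ν j)

/-- `ν_{(n,i)}`: the pushforward under `t ↦ tⁿ` of the measure `(t^i/γ_i(ν)) dν(t)`. -/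
noncomputable def nuPow (ν : MeasureTheory.Measure ℝ) (n i : ℕ) : MeasureTheory.Measure ℝ :=
  (ν.withDensity fun t => ENNReal.ofReal (t ^ i / mom ν i)).map fun t => t ^ n

/-- `ν₁`: the measure `(t/γ₁(ν)) dν(t)`. -/
noncomputable def nuOne (ν : MeasureTheory.Measure ℝ) : MeasureTheory.Measure ℝ :=
  ν.withDensity fun t => ENNReal.ofReal (t / mom ν 1)

/-- `∫ (1/t) dμ(t)`, as an extended real (`(0 : ℝ≥0∞)⁻¹ = ∞`). -/
noncomputable def invInt (μ : MeasureTheory.Measure ℝ) : ℝ≥0∞ :=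
  ∫⁻ t, (ENNReal.ofReal t)⁻¹ ∂μ

/-- The squared weights of a shift telescope to a quotient of moments. -/
lemma prod_wgt_sq (ν : Measure ℝ) (hν : ∀ j, 0 < mom ν j) (k n : ℕ) :
    ∏ j ∈ Finset.range n, wgt ν (j + k) ^ 2 = mom ν (n + k) / mom ν k := by
  induction n with
  | zero => simp [(hν k).ne']
  | succ n ih =>
    rw [Finset.prod_range_succ, ih, wgt, Real.sq_sqrt (div_pos (hν _) (hν _)).le,
      add_right_comm n 1 k]
    have h₀ := (hν (n + k)).ne'
    have h₁ := (hν k).ne'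
    field_simp

lemma ae_nonneg_of_Iio_null {ν : Measure ℝ} (h : ν (Set.Iio 0) = 0) : ∀ᵐ t ∂ν, 0 ≤ t := by
  rw [ae_iff]
  simpa [Set.Iio] using h

lemma measurable_ofReal_pow (n : ℕ) : Measurable fun t : ℝ => ENNReal.ofReal (t ^ n) := by
  fun_prop

lemma mom_nuOne (ν : Measure ℝ) (h : ν (Set.Iio 0) = 0) (h₁ : 0 < mom ν 1) (n : ℕ) :
    mom (nuOne ν) n = mom ν (n + 1) / mom ν 1 := by
  rw [mom, nuOne, integral_withDensity_eq_integral_toReal_smul (by fun_prop) (by simp),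
    show mom ν (n + 1) = ∫ t, t ^ (n + 1) ∂ν from rfl, ← integral_div]
  refine integral_congr_ae ?_
  filter_upwards [ae_nonneg_of_Iio_null h] with t ht
  rw [ENNReal.toReal_ofReal (div_nonneg ht h₁.le), smul_eq_mul]
  ring

lemma mom_map_pow (ν : Measure ℝ) (n : ℕ) : mom (ν.map fun t => t ^ n) 1 = mom ν n := by
  rw [mom, integral_map (by fun_prop) (by fun_prop)]
  simp [mom]

lemma nuPow_zero (ν : Measure ℝ) [IsProbabilityMeasure ν] (n : ℕ) :
    nuPow ν n 0 = ν.map fun t => t ^ n := by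
  simp [nuPow, mom]

lemma nuPow_one (ν : Measure ℝ) (n : ℕ) : nuPow ν n 1 = (nuOne ν).map fun t => t ^ n := by
  simp [nuPow, nuOne]

lemma nuOne_map_pow_apply (ν : Measure ℝ) (n : ℕ) (hn : 0 < mom ν n) {E : Set ℝ}
    (hE : MeasurableSet E) :
    nuOne (ν.map fun t => t ^ n) E = ENNReal.ofReal (mom ν n)⁻¹ *
      ∫⁻ t in (fun t => t ^ n) ⁻¹' E, ENNReal.ofReal (t ^ n) ∂ν := by
  rw [nuOne, mom_map_pow, withDensity_apply _ hE, setLIntegral_map hE (by fun_prop) (by fun_prop),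
    ← lintegral_const_mul _ (measurable_ofReal_pow n)]
  refine lintegral_congr fun t => ?_
  rw [← ENNReal.ofReal_mul (inv_nonneg.2 hn.le), div_eq_inv_mul]

/-- On measures carried by the positive half-line, domination is not affected by multiplying with
the density `tⁿ` and pushing forward along `t ↦ tⁿ`. -/
lemma setLIntegral_pow_le_iff_le {μ ν : Measure ℝ} {n : ℕ} (hn : n ≠ 0)
    (hμ : μ (Set.Iic 0) = 0) (hν : ν (Set.Iio 0) = 0) :
    (∀ E : Set ℝ, MeasurableSet E →
      ∫⁻ t in (fun t => t ^ n) ⁻¹' E, ENNReal.ofReal (t ^ n) ∂μ ≤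
        ∫⁻ t in (fun t => t ^ n) ⁻¹' E, ENNReal.ofReal (t ^ n) ∂ν) ↔ μ ≤ ν := by
  refine ⟨fun h => ?_, fun h E _ => lintegral_mono' (Measure.restrict_mono subset_rfl h) le_rfl⟩
  set g : ℝ → ℝ≥0∞ := fun t => ENNReal.ofReal (t ^ n) with hg
  have hgm : Measurable g := measurable_ofReal_pow n
  have hroot : ∀ t : ℝ, 0 ≤ t → (t ^ n) ^ (n⁻¹ : ℝ) = t := fun t ht =>
    Real.pow_rpow_inv_natCast ht hn
  have hset : ∀ (ρ : Measure ℝ), ρ (Set.Iio 0) = 0 → ∀ F : Set ℝ,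
      ((fun t : ℝ => t ^ n) ⁻¹' ((fun x : ℝ => x ^ (n⁻¹ : ℝ)) ⁻¹' F) : Set ℝ) =ᵐ[ρ] F := by
    intro ρ hρ F
    filter_upwards [ae_nonneg_of_Iio_null hρ] with t ht
    exact congrArg (fun x => F x) (hroot t ht)
  have hdens : μ.withDensity g ≤ ν.withDensity g := by
    refine Measure.le_iff.2 fun F hF => ?_
    have hE : MeasurableSet ((fun x : ℝ => x ^ (n⁻¹ : ℝ)) ⁻¹' F) :=
      (by fun_prop : Measurable fun x : ℝ => x ^ (n⁻¹ : ℝ)) hF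
    have := h _ hE
    rwa [setLIntegral_congr (hset μ (measure_mono_null Set.Iio_subset_Iic_self hμ) F),
      setLIntegral_congr (hset ν hν F), ← withDensity_apply _ hF, ← withDensity_apply _ hF] at this
  have hinv : ∀ ρ : Measure ℝ,
      ((ρ.withDensity g).restrict (Set.Ioi 0)).withDensity g⁻¹ = ρ.restrict (Set.Ioi 0) := by
    intro ρ
    rw [restrict_withDensity measurableSet_Ioi]
    refine withDensity_inv_same hgm ?_ (by simp [hg])
    filter_upwards [ae_restrict_mem measurableSet_Ioi] with t ht
    simpa [hg] using pow_pos ht n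
  have hμr : μ.restrict (Set.Ioi 0) = μ := by
    refine Measure.restrict_eq_self_of_ae_mem ?_
    rw [ae_iff]
    simpa [Set.Iic] using hμ
  calc μ = ((μ.withDensity g).restrict (Set.Ioi 0)).withDensity g⁻¹ := by rw [hinv, hμr]
    _ ≤ ((ν.withDensity g).restrict (Set.Ioi 0)).withDensity g⁻¹ := by
        refine Measure.le_iff.2 fun F hF => ?_
        rw [withDensity_apply _ hF, withDensity_apply _ hF]
        exact lintegral_mono'
          (Measure.restrict_mono subset_rfl (Measure.restrict_mono subset_rfl hdens)) le_rfl
    _ = ν.restrict (Set.Ioi 0) := hinv ν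
    _ ≤ ν := Measure.restrict_le_self

lemma measure_Iic_zero_of_invInt_ne_top {ν : Measure ℝ} (h : invInt ν ≠ ⊤) :
    ν (Set.Iic 0) = 0 := by
  have hae := ae_lt_top (by fun_prop : Measurable fun t : ℝ => (ENNReal.ofReal t)⁻¹) h
  rw [ae_iff] at hae
  simpa [Set.Iic] using hae

/-- Proposition 6.1(i): with `ψ := τ₁ − a²‖1/s‖_{L¹(ξ)}·η` and
`ψ^{(0,1)} := (τ_{(n,1)})₁ − (a²z₀²⋯z_{n−1}²/(y₁²⋯y_n²))‖1/s‖_{L¹(ξ)}·(η_{(n,0)})₁`,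
the signed measure `ψ^{(0,1)}` is positive iff `ψ` is positive. -/
theorem psi01_nonneg_iff_psi_nonneg
    (τ ξ η : Measure ℝ)
    [IsProbabilityMeasure τ] [IsProbabilityMeasure ξ] [IsProbabilityMeasure η]
    (hτ0 : τ (Set.Iio 0) = 0) (hξ0 : ξ (Set.Iio 0) = 0) (hη0 : η (Set.Iio 0) = 0)
    (hτc : ∃ R : ℝ, τ (Set.Ioi R) = 0) (hξc : ∃ R : ℝ, ξ (Set.Ioi R) = 0)
    (hηc : ∃ R : ℝ, η (Set.Ioi R) = 0)
    (hτm : ∀ j, 0 < mom τ j) (hξm : ∀ j, 0 < mom ξ j) (hηm : ∀ j, 0 < mom η j)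
    (a : ℝ) (ha : 0 < a) (n : ℕ) (hn : 2 ≤ n)
    (hξfin : invInt ξ ≠ ⊤) (hηfin : invInt η ≠ ⊤) :
    -- ψ^{(0,1)} ≥ 0
    ((∀ E : Set ℝ, MeasurableSet E →
        ENNReal.ofReal (a ^ 2 * (∏ j ∈ Finset.range n, wgt η j ^ 2) /
            (∏ j ∈ Finset.range n, wgt τ (j + 1) ^ 2)) * invInt ξ *
          nuOne (nuPow η n 0) E ≤ nuOne (nuPow τ n 1) E) ↔
    -- ψ ≥ 0
      (∀ E : Set ℝ, MeasurableSet E →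
        ENNReal.ofReal (a ^ 2) * invInt ξ * η E ≤ nuOne τ E)) := by
  have hτ₁ : nuOne τ (Set.Iio 0) = 0 := withDensity_absolutelyContinuous _ _ hτ0
  have hmom : ∀ j, mom (nuOne τ) j = mom τ (j + 1) / mom τ 1 := mom_nuOne τ hτ0 (hτm 1)
  have hpos : 0 < mom (nuOne τ) n := by rw [hmom]; exact div_pos (hτm _) (hτm _)
  have hη := prod_wgt_sq η hηm 0 n
  have hη₀ : mom η 0 = 1 := by simp [mom]
  simp only [add_zero, hη₀, div_one] at hη
  rw [hη, prod_wgt_sq τ hτm 1 n, ← hmom, nuPow_zero, nuPow_one]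
  set c : ℝ≥0∞ := ENNReal.ofReal (a ^ 2) * invInt ξ with hc
  have hcη : (c • η) (Set.Iic 0) = 0 := by
    simp [measure_Iic_zero_of_invInt_ne_top hηfin]
  have hright : (∀ E : Set ℝ, MeasurableSet E → c * η E ≤ nuOne τ E) ↔ c • η ≤ nuOne τ := by
    simp [Measure.le_iff]
  rw [hright, ← setLIntegral_pow_le_iff_le (by lia : n ≠ 0) hcη hτ₁]
  refine forall₂_congr fun E hE => ?_
  rw [nuOne_map_pow_apply η n (hηm n) hE, nuOne_map_pow_apply (nuOne τ) n hpos hE,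
    Measure.restrict_smul, lintegral_smul_measure, smul_eq_mul]
  have hcoef : ENNReal.ofReal (a ^ 2 * mom η n / mom (nuOne τ) n) * invInt ξ *
      ENNReal.ofReal (mom η n)⁻¹ = ENNReal.ofReal (mom (nuOne τ) n)⁻¹ * c := by
    rw [mul_right_comm, ← ENNReal.ofReal_mul (by have := (hηm n).le; positivity), hc, ← mul_assoc,
      ← ENNReal.ofReal_mul (by positivity)]
    have := (hηm n).ne'
    congr 2
    field_simp
  rw [← mul_assoc, hcoef, mul_assoc]
  exact ENNReal.mul_le_mul_iff_right (by simpa using hpos) ENNReal.ofReal_ne_top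

end
end

section
/- Let α = (α_k)_{k≥0} be a bounded sequence of strictly positive reals such that W_α is subnormal with Berger measure μ, let m ≥ 1 and 0 ≤ i ≤ m−1, and define the sequence α(m:i) by α(m:i)_j := α_{mj+i}·α_{mj+i+1}·⋯·α_{mj+i+m−1}. Let μ_{(m,i)} be the pushforward under s ↦ sᵐ of the measure (sⁱ/γ_i(α)) dμ(s). Then μ_{(m,i)} is a Borel probability measure on [0,∞) and ∫ s^j dμ_{(m,i)}(s) = γ_j(α(m:i)) for every j ≥ 0; that is, W_{α(m:i)} is subnormal with Berger measure μ_{(m,i)}. -/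
open MeasureTheory
open scoped ENNReal

noncomputable section

/-- A sequence product over `range (i + m * j)` splits off its first `i` factors and groups the
remaining ones in `j` blocks of length `m`. -/
theorem prod_range_add_mul_eq_prod_blocks {M : Type*} [CommMonoid M] (f : ℕ → M) (m i j : ℕ) :
    ∏ k ∈ Finset.range (i + m * j), f k =
      (∏ k ∈ Finset.range i, f k) *
        ∏ r ∈ Finset.range j, ∏ k ∈ Finset.range m, f (m * r + i + k) := by
  induction j with
  | zero => simp
  | succ j ih =>
    rw [Nat.mul_succ, ← add_assoc, Finset.prod_range_add, ih, Finset.prod_range_succ, mul_assoc,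
      add_comm i]

/-- Integration against a pushforward, under a power map, of a measure with density
`s ↦ s ^ i / c`. -/
theorem integral_pow_map_pow_withDensity {μ : Measure ℝ} (hμ : ∀ᵐ s ∂μ, 0 ≤ s) {c : ℝ}
    (hc : 0 ≤ c) (m i j : ℕ) :
    ∫ s, s ^ j ∂((μ.withDensity fun s => ENNReal.ofReal (s ^ i / c)).map fun s => s ^ m) =
      (∫ s, s ^ (i + m * j) ∂μ) / c := by
  rw [integral_map (by fun_prop) (by fun_prop),
    integral_withDensity_eq_integral_toReal_smul (by fun_prop) (by simp), ← integral_div]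
  refine integral_congr_ae ?_
  filter_upwards [hμ] with s hs
  rw [ENNReal.toReal_ofReal (by positivity), smul_eq_mul, pow_add, pow_mul]
  ring

/-- Lemma 2.2 ([CuP, Theorem 2.9]): if `W_α` is subnormal with Berger measure `μ`, `m ≥ 1`,
`0 ≤ i ≤ m−1`, then the pushforward `μ_{(m,i)}` under `s ↦ sᵐ` of `(sⁱ/γ_i(α)) dμ(s)` is a
probability measure on `[0,∞)` whose moments are `γ_j(α(m:i))`; i.e. `W_{α(m:i)}` is
subnormal with Berger measure `μ_{(m,i)}`. -/
theorem power_berger_measure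
    (α : ℕ → ℝ) (hαpos : ∀ j, 0 < α j) (hαbdd : ∃ C : ℝ, ∀ j, α j ≤ C)
    (μ : Measure ℝ) [IsProbabilityMeasure μ]
    (hμ0 : μ (Set.Iio 0) = 0) (hμc : ∃ R : ℝ, μ (Set.Ioi R) = 0)
    (hmom : ∀ k : ℕ, (∏ j ∈ Finset.range k, α j ^ 2) = ∫ t, t ^ k ∂μ)
    (m : ℕ) (hm : 1 ≤ m) (i : ℕ) (hi : i ≤ m - 1) :
    IsProbabilityMeasure
      ((μ.withDensity fun s =>
          ENNReal.ofReal (s ^ i / ∏ j ∈ Finset.range i, α j ^ 2)).map fun s => s ^ m) ∧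
    ((μ.withDensity fun s =>
        ENNReal.ofReal (s ^ i / ∏ j ∈ Finset.range i, α j ^ 2)).map fun s => s ^ m)
      (Set.Iio 0) = 0 ∧
    (∀ j : ℕ,
      (∫ s, s ^ j
          ∂((μ.withDensity fun s =>
              ENNReal.ofReal (s ^ i / ∏ r ∈ Finset.range i, α r ^ 2)).map
            fun s => s ^ m)) =
        ∏ r ∈ Finset.range j, (∏ k ∈ Finset.range m, α (m * r + i + k)) ^ 2) := by
  have hμ : ∀ᵐ s ∂μ, 0 ≤ s := by
    rw [ae_iff]
    simp only [not_le]
    exact hμ0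
  have hγ (k : ℕ) : 0 < ∏ j ∈ Finset.range k, α j ^ 2 :=
    Finset.prod_pos fun j _ => pow_pos (hαpos j) 2
  have hint : Integrable (fun s : ℝ => s ^ i) μ :=
    Integrable.of_integral_ne_zero (hmom i ▸ (hγ i).ne')
  refine ⟨⟨?_⟩, ?_, fun j => ?_⟩
  · rw [Measure.map_apply (by fun_prop) MeasurableSet.univ, Set.preimage_univ,
      withDensity_apply _ MeasurableSet.univ, Measure.restrict_univ,
      ← ofReal_integral_eq_lintegral_ofReal (hint.div_const _), integral_div, ← hmom,
      div_self (hγ i).ne', ENNReal.ofReal_one]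
    filter_upwards [hμ] with s hs
    exact div_nonneg (pow_nonneg hs i) (hγ i).le
  · rw [Measure.map_apply (by fun_prop) measurableSet_Iio]
    refine withDensity_absolutelyContinuous _ _ (measure_mono_null ?_ hμ0)
    exact fun s hs => Set.mem_Iio.2 (lt_of_not_ge fun h => (pow_nonneg h m).not_gt hs)
  · rw [integral_pow_map_pow_withDensity hμ (hγ i).le, ← hmom,
      prod_range_add_mul_eq_prod_blocks, mul_div_cancel_left₀ _ (hγ i).ne']
    simp only [Finset.prod_pow]

end
end

section
/- Let W := shift(1/3, 1/2, 1, 1, …) be the unilateral weighted shift on ℓ²(ℤ₊) with weight sequence α₀ = 1/3, α₁ = 1/2, and α_n = 1 for n ≥ 2. Then: (a) for every integer n ≥ 2, the operator Wⁿ is subnormal; (b) the restriction of W to the closed span of {e_k : k ≥ 1} is subnormal; (c) W itself is not subnormal. -/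
open MeasureTheory
open scoped ENNReal

noncomputable section

/-- The Hilbert space `ℓ²(ℤ₊)`. -/
abbrev H1 : Type := lp (fun _ : ℕ => ℂ) 2

/-- The canonical orthonormal basis vectors of `ℓ²(ℤ₊)`. -/
noncomputable def e1 (n : ℕ) : H1 := lp.single 2 n 1

/-- The invariant subspace `L₁`: the closed span of `{e_k : k ≥ 1}` in `ℓ²(ℤ₊)`. -/
noncomputable def L1 : Submodule ℂ H1 :=
  (Submodule.span ℂ {x : H1 | ∃ k : ℕ, 1 ≤ k ∧ x = e1 k}).topologicalClosure

open scoped InnerProductSpace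

lemma IsStarNormal.norm_adjoint_apply {K : Type*} [NormedAddCommGroup K] [InnerProductSpace ℂ K]
    [CompleteSpace K] {N : K →L[ℂ] K} (hN : IsStarNormal N) (x : K) :
    ‖N.adjoint x‖ = ‖N x‖ :=
  ((ContinuousLinearMap.isStarNormal_iff_norm_eq_adjoint).1 hN x).symm

/-- If the second difference of the moments `‖N ^ k v‖ ^ 2` at `k = 2, 3, 4` vanishes, then the
moments at `k = 1` and `k = 2` agree. -/
lemma IsStarNormal.norm_apply_sq_eq {K : Type*} [NormedAddCommGroup K]
    [InnerProductSpace ℂ K] [CompleteSpace K] {N : K →L[ℂ] K} (hN : IsStarNormal N) (v : K)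
    (h : ‖N (N v)‖ ^ 2 - 2 * ‖N (N (N v))‖ ^ 2 + ‖N (N (N (N v)))‖ ^ 2 = 0) :
    ‖N v‖ ^ 2 = ‖N (N v)‖ ^ 2 := by
  have hcomm : ∀ x, N.adjoint (N x) = N (N.adjoint x) := fun x =>
    DFunLike.congr_fun hN.star_comm_self.eq x
  set w := N.adjoint (N v) with hw
  have hw1 : ‖w‖ = ‖N (N v)‖ := hN.norm_adjoint_apply _
  have hw2 : ‖N w‖ = ‖N (N (N v))‖ := by
    rw [hw, ← hcomm, hN.norm_adjoint_apply]
  have hw3 : ‖N.adjoint (N w)‖ = ‖N (N (N (N v)))‖ := by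
    rw [hN.norm_adjoint_apply, hw, ← hcomm, ← hcomm, hN.norm_adjoint_apply]
  have hzero : ‖N.adjoint (N w) - w‖ ^ 2 = 0 := by
    rw [@norm_sub_sq ℂ, ContinuousLinearMap.adjoint_inner_left, inner_self_eq_norm_sq, hw1, hw2,
      hw3]
    linarith
  have hfix : N.adjoint (N w) = w := by
    rwa [sq_eq_zero_iff, norm_eq_zero, sub_eq_zero] at hzero
  have h1 : ⟪w, v⟫_ℂ = (‖N v‖ : ℂ) ^ 2 := by
    rw [hw, ContinuousLinearMap.adjoint_inner_left, inner_self_eq_norm_sq_to_K]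
    rfl
  have h2 : ⟪N.adjoint (N w), v⟫_ℂ = (‖w‖ : ℂ) ^ 2 := by
    rw [ContinuousLinearMap.adjoint_inner_left, ← ContinuousLinearMap.adjoint_inner_right,
      inner_self_eq_norm_sq_to_K]
    rfl
  rw [hfix, h1, hw1] at h2
  exact_mod_cast h2

/-- A Hilbert basis permuted by a self-equivalence of its index set. -/
def HilbertBasis.permute {ι E : Type*} [NormedAddCommGroup E] [InnerProductSpace ℂ E]
    [CompleteSpace E] (b : HilbertBasis ι ℂ E) (σ : ι ≃ ι) : HilbertBasis ι ℂ E :=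
  HilbertBasis.mk (b.orthonormal.comp σ σ.injective)
    (by rw [σ.surjective.range_comp, b.dense_span])

lemma HilbertBasis.exists_unitary_permuting {ι E : Type*} [NormedAddCommGroup E]
    [InnerProductSpace ℂ E] [CompleteSpace E] (b : HilbertBasis ι ℂ E) (σ : ι ≃ ι) :
    ∃ U : E ≃ₗᵢ[ℂ] E, ∀ i, U (b i) = b (σ i) := by
  classical
  refine ⟨b.repr.trans (b.permute σ).repr.symm, fun i => ?_⟩
  rw [LinearIsometryEquiv.trans_apply, b.repr_self, HilbertBasis.repr_symm_single]
  simp [HilbertBasis.permute]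

/-- The direct sum of a unitary operator with a zero operator is normal. -/
lemma isStarNormal_unitary_sum_zero {E F : Type*} [NormedAddCommGroup E]
    [InnerProductSpace ℂ E] [CompleteSpace E] [NormedAddCommGroup F] [InnerProductSpace ℂ F]
    [CompleteSpace F] (U : E ≃ₗᵢ[ℂ] E) :
    ∃ N : WithLp 2 (E × F) →L[ℂ] WithLp 2 (E × F), IsStarNormal N ∧
      ∀ x y, N (WithLp.toLp 2 (x, y)) = WithLp.toLp 2 (U x, 0) := by
  let sum (T : E →L[ℂ] E) : WithLp 2 (E × F) →L[ℂ] WithLp 2 (E × F) :=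
    (WithLp.prodContinuousLinearEquiv 2 ℂ E F).symm.toContinuousLinearMap ∘L
      (T.prodMap 0) ∘L (WithLp.prodContinuousLinearEquiv 2 ℂ E F).toContinuousLinearMap
  have sum_apply (T : E →L[ℂ] E) (z : WithLp 2 (E × F)) :
      sum T z = WithLp.toLp 2 (T z.fst, 0) := rfl
  have hadj : sum (U.symm : E →L[ℂ] E) = (sum (U : E →L[ℂ] E)).adjoint := by
    rw [ContinuousLinearMap.eq_adjoint_iff]
    intro x y
    simpa [sum_apply, WithLp.prod_inner_apply] using (U.symm.inner_map_eq_flip x.fst y.fst)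
  refine ⟨sum (U : E →L[ℂ] E), ⟨?_⟩, fun x y => rfl⟩
  rw [ContinuousLinearMap.star_eq_adjoint, ← hadj]
  ext z
  all_goals simp [sum_apply]

lemma orthonormal_e1 : Orthonormal ℂ e1 := by
  classical
  rw [orthonormal_iff_ite]
  intro i j
  simp only [e1, lp.inner_single_left, lp.single_apply]
  by_cases h : i = j
  · subst h; simp
  · simp [h]

lemma span_e1_topologicalClosure : (Submodule.span ℂ (Set.range e1)).topologicalClosure = ⊤ := by
  let b : HilbertBasis ℕ ℂ H1 := ⟨LinearIsometryEquiv.refl ℂ _⟩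
  have hb : ⇑b = e1 := by
    classical
    funext k
    rw [← b.repr_symm_single]
    rfl
  rw [← hb, b.dense_span]

/-- A common normal dilation for the weighted shifts `e_k ↦ d_k e_{k + n}` with weights
`d_k ∈ [-1, 1]`; it extends the shift at each `e_k` with `d_{k + n} = 1`. -/
lemma exists_normal_dilation (d : ℕ → ℝ) (hd : ∀ k, d k ^ 2 ≤ 1) (n : ℕ) :
    ∃ (K : Type) (_ : NormedAddCommGroup K) (_ : InnerProductSpace ℂ K)
      (_ : CompleteSpace K) (V : H1 →ₗᵢ[ℂ] K) (N : K →L[ℂ] K), IsStarNormal N ∧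
      ∀ k, d (k + n) = 1 → N (V (e1 k)) = V ((d k : ℂ) • e1 (k + n)) := by
  classical
  let b : HilbertBasis ℤ ℂ (lp (fun _ : ℤ => ℂ) 2) := ⟨LinearIsometryEquiv.refl ℂ _⟩
  obtain ⟨U, hU⟩ := b.exists_unitary_permuting (Equiv.addRight (n : ℤ))
  obtain ⟨N, hN, hNapply⟩ := isStarNormal_unitary_sum_zero (F := H1) U
  let s (k : ℕ) : ℝ := √(1 - d k ^ 2)
  let v (k : ℕ) : WithLp 2 (lp (fun _ : ℤ => ℂ) 2 × H1) :=
    WithLp.toLp 2 ((d k : ℂ) • b k, (s k : ℂ) • e1 k)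
  have hv : Orthonormal ℂ v := by
    rw [orthonormal_iff_ite]
    intro i j
    simp only [v, WithLp.prod_inner_apply, inner_smul_left, inner_smul_right,
      orthonormal_iff_ite.1 b.orthonormal, orthonormal_iff_ite.1 orthonormal_e1, Nat.cast_inj]
    split_ifs with h
    · subst h
      have hs : s i ^ 2 = 1 - d i ^ 2 := Real.sq_sqrt (sub_nonneg.2 (hd i))
      have : d i * d i + s i * s i = 1 := by linarith
      simpa using congrArg (fun r : ℝ => (r : ℂ)) this
    · simp
  let V := hv.orthogonalFamily.linearIsometry
  have hV (k : ℕ) : V (e1 k) = v k := by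
    simp [V, e1]
  refine ⟨_, inferInstance, inferInstance, inferInstance, V, N, hN, fun k hk => ?_⟩
  rw [map_smul, hV, hV, hNapply]
  have hUk : U (b k) = b ((k + n : ℕ) : ℤ) := by simp [hU]
  simp only [v, s, hk, map_smul, hUk]
  simp [← WithLp.toLp_smul]

/-- For `W = shift(1/3, 1/2, 1, 1, …)`: every power `Wⁿ` (`n ≥ 2`) is subnormal, the
restriction of `W` to the closed span of `{e_k : k ≥ 1}` is subnormal, but `W` itself is
not subnormal. -/
theorem shift_powers_and_restriction_subnormal_but_not_subnormal
    (W : H1 →L[ℂ] H1)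
    (hW : ∀ j : ℕ, W (e1 j) =
      ((if j = 0 then (1 / 3 : ℝ) else if j = 1 then 1 / 2 else 1) : ℂ) • e1 (j + 1)) :
    (∀ n : ℕ, 2 ≤ n → IsSubnormalOp (W ^ n)) ∧
    (∃ S : L1 →L[ℂ] L1, (∀ x : L1, (S x : H1) = W x) ∧ IsSubnormalOp S) ∧
    ¬ IsSubnormalOp W := by
  have hpow (m k : ℕ) : (W ^ (m + 2)) (e1 k) =
      (((if k = 0 then 1 / 6 else if k = 1 then 1 / 2 else 1 : ℝ)) : ℂ) • e1 (k + (m + 2)) := by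
    induction m with
    | zero =>
      rw [zero_add, pow_two, mul_apply_eq_comp, hW, map_smul, hW, smul_smul]
      rcases k with _ | _ | k <;> norm_num
    | succ m ih =>
      rw [show m + 1 + 2 = (m + 2) + 1 by ring, pow_succ', mul_apply_eq_comp, ih,
        map_smul, hW, if_neg (by omega : k + (m + 2) ≠ 0), if_neg (by omega : k + (m + 2) ≠ 1),
        one_smul, show k + (m + 2) + 1 = k + (m + 2 + 1) by ring]
  refine ⟨fun n hn => ?_, ?_, ?_⟩
  · obtain ⟨m, rfl⟩ := Nat.exists_eq_add_of_le' hn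
    obtain ⟨K, i₁, i₂, i₃, V, N, hN, h⟩ := exists_normal_dilation
      (fun k => if k = 0 then 1 / 6 else if k = 1 then 1 / 2 else 1)
      (fun k => by split_ifs <;> norm_num) (m + 2)
    refine ⟨K, i₁, i₂, i₃, V, N, hN, fun x => ?_⟩
    have heq : N ∘L V.toContinuousLinearMap = V.toContinuousLinearMap ∘L W ^ (m + 2) := by
      refine ContinuousLinearMap.ext_on
        (Submodule.dense_iff_topologicalClosure_eq_top.2 span_e1_topologicalClosure) ?_
      rintro _ ⟨k, rfl⟩
      simpa [hpow] using h k (by simp [show k + (m + 2) ≠ 1 by omega])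
    exact DFunLike.congr_fun heq x
  · have hmaps : L1 ≤ L1.comap (W : H1 →ₗ[ℂ] H1) := by
      refine Submodule.topologicalClosure_minimal _ (Submodule.span_le.2 ?_)
        ((Submodule.isClosed_topologicalClosure _).preimage W.continuous)
      rintro _ ⟨k, hk, rfl⟩
      change W (e1 k) ∈ L1
      rw [hW]
      exact L1.smul_mem _ (Submodule.le_topologicalClosure _
        (Submodule.subset_span ⟨k + 1, by omega, rfl⟩))
    refine ⟨(W ∘L L1.subtypeL).codRestrict L1 fun x => hmaps x.2, fun x => rfl, ?_⟩
    obtain ⟨K, i₁, i₂, i₃, V, N, hN, h⟩ := exists_normal_dilation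
      (fun k => if k = 1 then 1 / 2 else 1) (fun k => by split_ifs <;> norm_num) 1
    refine ⟨K, i₁, i₂, i₃, V.comp L1.subtypeₗᵢ, N, hN, fun x => ?_⟩
    have heq : L1 ≤ LinearMap.eqLocus (N ∘L V.toContinuousLinearMap).toLinearMap
        (V.toContinuousLinearMap ∘L W).toLinearMap := by
      refine Submodule.topologicalClosure_minimal _ (Submodule.span_le.2 ?_)
        (isClosed_eq (N ∘L V.toContinuousLinearMap).continuous
          (V.toContinuousLinearMap ∘L W).continuous)
      rintro _ ⟨k, hk, rfl⟩
      have hk0 : k ≠ 0 := by omega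
      simpa [hW, hk0, apply_ite] using h k (by simp [hk0])
    exact heq x.2
  · rintro ⟨K, _, _, _, V, N, hN, h⟩
    have h1 : N (V (e1 0)) = V ((1 / 3 : ℂ) • e1 1) := by simp [h, hW]
    have h2 : N (N (V (e1 0))) = V ((1 / 6 : ℂ) • e1 2) := by
      rw [h1, h, map_smul, hW, smul_smul]; norm_num
    have h3 : N (N (N (V (e1 0)))) = V ((1 / 6 : ℂ) • e1 3) := by
      rw [h2, h, map_smul, hW, smul_smul]; norm_num
    have h4 : N (N (N (N (V (e1 0))))) = V ((1 / 6 : ℂ) • e1 4) := by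
      rw [h3, h, map_smul, hW, smul_smul]; norm_num
    have hmom := hN.norm_apply_sq_eq (V (e1 0))
    rw [h4, h3, h2, h1] at hmom
    simp only [LinearIsometry.norm_map, norm_smul, orthonormal_e1.1] at hmom
    norm_num at hmom

end
end

section
/- For every real α₀ > 0, the unilateral weighted shift shift(α₀, 1/2, 1, 1, …) (weight sequence α₀ followed by 1/2 and then all weights equal to 1) is not subnormal; that is, no subnormal backward extension of shift(1/2, 1, 1, …) exists. -/
open MeasureTheory
open scoped ENNReal

noncomputable section

open ContinuousLinearMap in
/-- A normal operator that is isometric on `b` and on `N b` satisfies `N† N b = b`. -/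
theorem adjoint_apply_self_of_norm_eq {K : Type*} [NormedAddCommGroup K] [InnerProductSpace ℂ K]
    [CompleteSpace K] {N : K →L[ℂ] K} (hN : IsStarNormal N) {b : K}
    (h₁ : ‖N b‖ = ‖b‖) (h₂ : ‖N (N b)‖ = ‖b‖) : adjoint N (N b) = b := by
  have hadj : ‖adjoint N (N b)‖ = ‖b‖ := by
    rw [← isStarNormal_iff_norm_eq_adjoint.1 hN, h₂]
  have hre : RCLike.re (inner ℂ (adjoint N (N b)) b) = ‖b‖ ^ 2 := by
    rw [adjoint_inner_left, inner_self_eq_norm_sq, h₁]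
  have hsq := norm_sub_sq (𝕜 := ℂ) (adjoint N (N b)) b
  rw [hadj, hre] at hsq
  have hzero : ‖adjoint N (N b) - b‖ ^ 2 = 0 := by linarith
  exact sub_eq_zero.1 (norm_eq_zero.1 (pow_eq_zero_iff two_ne_zero |>.1 hzero))

open ContinuousLinearMap in
/-- If `a = N x` for a normal operator `N` and `N† N` fixes `N a`, then `‖N a‖ = ‖a‖`. -/
theorem norm_apply_eq_of_adjoint_apply_self {K : Type*} [NormedAddCommGroup K]
    [InnerProductSpace ℂ K] [CompleteSpace K] {N : K →L[ℂ] K} (hN : IsStarNormal N) {x a : K}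
    (hx : N x = a) (ha : adjoint N (N (N a)) = N a) : ‖N a‖ = ‖a‖ := by
  have hcomm : N (adjoint N (N a)) = adjoint N (N (N a)) :=
    (DFunLike.congr_fun hN.star_comm_self.eq (N a)).symm
  have hker : adjoint N (adjoint N (N a) - a) = 0 := by
    rw [← norm_eq_zero, ← isStarNormal_iff_norm_eq_adjoint.1 hN, map_sub, hcomm, ha, sub_self,
      norm_zero]
  have horth : inner ℂ (adjoint N (N a) - a) a = 0 := by
    nth_rw 3 [← hx]
    rw [← adjoint_inner_left, hker, inner_zero_left]
  rw [inner_sub_left, adjoint_inner_left, inner_self_eq_norm_sq_to_K,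
    inner_self_eq_norm_sq_to_K, sub_eq_zero] at horth
  norm_cast at horth
  exact (sq_eq_sq₀ (norm_nonneg _) (norm_nonneg _)).1 horth

theorem norm_e1 (n : ℕ) : ‖e1 n‖ = 1 := by
  simp [e1, lp.norm_single]

/-- No backward extension `shift(α₀, 1/2, 1, 1, …)` of `shift(1/2, 1, 1, …)` is subnormal. -/
theorem no_subnormal_backward_extension
    (α₀ : ℝ) (hα₀ : 0 < α₀)
    (W : H1 →L[ℂ] H1)
    (hW : ∀ j : ℕ, W (e1 j) =
      ((if j = 0 then α₀ else if j = 1 then 1 / 2 else 1) : ℂ) • e1 (j + 1)) :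
    ¬ IsSubnormalOp W := by
  rintro ⟨K, _, _, _, V, N, hN, hV⟩
  have hnorm (n : ℕ) : ‖V (e1 n)‖ = 1 := by rw [V.norm_map, norm_e1]
  have h₀ : N (V (e1 0)) = (α₀ : ℂ) • V (e1 1) := by simp [hV, hW, -Complex.coe_smul]
  have h₁ : N (V (e1 1)) = (1 / 2 : ℂ) • V (e1 2) := by simp [hV, hW]
  have h₂ : N (V (e1 2)) = V (e1 3) := by simp [hV, hW]
  have h₃ : N (V (e1 3)) = V (e1 4) := by simp [hV, hW]
  have hfix : ContinuousLinearMap.adjoint N (N (V (e1 2))) = V (e1 2) :=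
    adjoint_apply_self_of_norm_eq hN (by rw [h₂, hnorm, hnorm]) (by rw [h₂, h₃, hnorm, hnorm])
  have hα : (α₀ : ℂ) ≠ 0 := by exact_mod_cast hα₀.ne'
  have hiso : ‖N (V (e1 1))‖ = ‖V (e1 1)‖ :=
    norm_apply_eq_of_adjoint_apply_self hN (x := (α₀ : ℂ)⁻¹ • V (e1 0))
      (by rw [map_smul, h₀, inv_smul_smul₀ hα])
      (by rw [h₁, map_smul, map_smul, hfix])
  rw [h₁, norm_smul, hnorm, hnorm] at hiso
  norm_num at hiso

end
end

section
/- Let α = (α_n)_{n≥0} be a bounded sequence of strictly positive reals such that the restricted shift shift(α₁, α₂, …) is subnormal with Berger measure μ. Then W_α is subnormal if and only if ∫(1/t)dμ(t) < ∞ and α₀²·∫(1/t)dμ(t) ≤ 1. -/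
open MeasureTheory
open scoped ENNReal

noncomputable section

/-- The powers of `star N * N` compute the norms of the iterates of a normal operator `N`. -/
lemma inner_pow_star_mul_self {K : Type*} [NormedAddCommGroup K] [InnerProductSpace ℂ K]
    [CompleteSpace K] (N : K →L[ℂ] K) (hN : IsStarNormal N) (v : K) (k : ℕ) :
    inner ℂ v (((star N * N) ^ k) v) = ((‖(N ^ k) v‖ ^ 2 : ℝ) : ℂ) := by
  rw [hN.star_comm_self.mul_pow, ← star_pow, ContinuousLinearMap.star_eq_adjoint]
  change inner ℂ v ((ContinuousLinearMap.adjoint (N ^ k)) ((N ^ k) v)) = _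
  rw [ContinuousLinearMap.adjoint_inner_right, inner_self_eq_norm_sq_to_K]
  norm_cast

/-- The norms of the orbit of `e₀` under a weighted shift are the square roots of the moments. -/
lemma norm_pow_extension_apply {K : Type*} [NormedAddCommGroup K] [InnerProductSpace ℂ K]
    (α : ℕ → ℝ) (W : H1 →L[ℂ] H1) (hW : ∀ j : ℕ, W (e1 j) = (α j : ℂ) • e1 (j + 1))
    (V : H1 →ₗᵢ[ℂ] K) (N : K →L[ℂ] K) (hNV : ∀ x, N (V x) = V (W x)) (k : ℕ) :
    ‖(N ^ k) (V (e1 0))‖ ^ 2 = ∏ j ∈ Finset.range k, α j ^ 2 := by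
  have h : (N ^ k) (V (e1 0)) = ((∏ j ∈ Finset.range k, α j : ℝ) : ℂ) • V (e1 k) := by
    induction k with
    | zero => simp
    | succ k ih =>
      rw [pow_succ']
      change N ((N ^ k) (V (e1 0))) = _
      rw [ih, map_smul, hNV, hW, map_smul, smul_smul, Finset.prod_range_succ]
      push_cast
      rfl
  have he : ‖e1 k‖ = 1 := by simp [e1, lp.norm_single]
  rw [h, norm_smul, V.norm_map, he, mul_one, Complex.norm_real, Real.norm_eq_abs, sq_abs,
    Finset.prod_pow]

/-- If the orbit of `v` under a self-adjoint `A` has moments `⟪v, A ^ (k + 1) v⟫ = c ∫ t ^ k ∂μ`,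
then the moment functional of `μ` is the quadratic form of `A * p(A)` at `v`. -/
lemma integral_eval_eq_re_inner {K : Type*} [NormedAddCommGroup K] [InnerProductSpace ℂ K]
    (A : K →L[ℂ] K) (v : K) (c : ℝ) (μ : Measure ℝ)
    (hint : ∀ k : ℕ, Integrable (fun t : ℝ => t ^ k) μ)
    (h : ∀ k : ℕ, inner ℂ v ((A ^ (k + 1)) v) = ((c * ∫ t, t ^ k ∂μ : ℝ) : ℂ))
    (p : Polynomial ℝ) :
    Integrable (fun t => p.eval t) μ ∧
      c * ∫ t, p.eval t ∂μ
        = (inner ℂ v ((Polynomial.aeval A (Polynomial.X * p)) v)).re := by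
  induction p using Polynomial.induction_on' with
  | add p q hp hq =>
    refine ⟨by simpa only [Polynomial.eval_add] using! hp.1.add hq.1, ?_⟩
    simp only [Polynomial.eval_add, mul_add, map_add, add_apply,
      inner_add_right, Complex.add_re]
    rw [integral_add hp.1 hq.1, mul_add, hp.2, hq.2]
  | monomial n a =>
    refine ⟨by simpa using (hint n).const_mul a, ?_⟩
    have h1 : Polynomial.aeval A (Polynomial.X * Polynomial.monomial n a)
        = (a : ℂ) • A ^ (n + 1) := by
      rw [Polynomial.X_mul_monomial, Polynomial.aeval_monomial, ← Algebra.smul_def]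
      ext x
      simp
    rw [h1]
    simp only [Polynomial.eval_monomial, smul_apply, inner_smul_right, h n,
      integral_const_mul]
    rw [← Complex.ofReal_mul, Complex.ofReal_re]
    ring

/-- Even powers of a self-adjoint operator have nonnegative quadratic forms. -/
lemma inner_pow_two_mul_of_isSelfAdjoint {K : Type*} [NormedAddCommGroup K]
    [InnerProductSpace ℂ K] [CompleteSpace K] (B : K →L[ℂ] K) (hB : IsSelfAdjoint B) (v : K)
    (n : ℕ) : inner ℂ v ((B ^ (2 * n)) v) = ((‖(B ^ n) v‖ ^ 2 : ℝ) : ℂ) := by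
  rw [two_mul, pow_add]
  change inner ℂ v ((B ^ n) ((B ^ n) v)) = _
  rw [← ContinuousLinearMap.adjoint_inner_left, ← ContinuousLinearMap.star_eq_adjoint,
    (hB.pow n).star_eq, inner_self_eq_norm_sq_to_K]
  norm_cast

/-- A measure on `[0, M]` whose moments come from a self-adjoint operator as in
`⟪v, A ^ (k + 1) v⟫ = c ∫ t ^ k ∂μ` satisfies `c ∫ 1/t ∂μ ≤ ‖v‖ ^ 2`. -/
lemma lintegral_inv_le_of_moments {K : Type*} [NormedAddCommGroup K] [InnerProductSpace ℂ K]
    [CompleteSpace K] (A : K →L[ℂ] K) (hA : IsSelfAdjoint A) (v : K) (c : ℝ) (hc : 0 < c)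
    (μ : Measure ℝ) (M : ℝ) (hM : 0 < M) (hμ : ∀ᵐ t ∂μ, 0 ≤ t ∧ t ≤ M)
    (hint : ∀ k : ℕ, Integrable (fun t : ℝ => t ^ k) μ)
    (h : ∀ k : ℕ, inner ℂ v ((A ^ (k + 1)) v) = ((c * ∫ t, t ^ k ∂μ : ℝ) : ℂ)) :
    ∫⁻ t, (ENNReal.ofReal t)⁻¹ ∂μ ≤ ENNReal.ofReal (‖v‖ ^ 2 / c) := by
  let q : Polynomial ℝ := 1 - Polynomial.C M⁻¹ * Polynomial.X
  let p : ℕ → Polynomial ℝ := fun n =>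
    Polynomial.C M⁻¹ * ∑ k ∈ Finset.range (2 * n), q ^ k
  have hq : ∀ t : ℝ, q.eval t = 1 - t / M := fun t => by
    simp [q]; ring
  let B : K →L[ℂ] K := 1 - ((M⁻¹ : ℝ) : ℂ) • A
  have hB : Polynomial.aeval A q = B := by
    simp only [q, B, map_sub, map_one, map_mul, Polynomial.aeval_C, Polynomial.aeval_X,
      ← Algebra.smul_def]
    rfl
  have hBs : IsSelfAdjoint B := by
    rw [isSelfAdjoint_iff, star_sub, star_one, star_smul, hA.star_eq, ← starRingEnd_apply,
      Complex.conj_ofReal]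
  have hXp : ∀ n, Polynomial.X * p n = 1 - q ^ (2 * n) := fun n => by
    rw [← mul_neg_geom_sum]
    simp only [p, q]
    ring
  have hp : ∀ n (t : ℝ), (p n).eval t = M⁻¹ * ∑ k ∈ Finset.range (2 * n), (1 - t / M) ^ k :=
    fun n t => by simp [p, Polynomial.eval_finsetSum, hq]
  have hbase : ∀ t : ℝ, t ≤ M → 0 ≤ 1 - t / M := fun t ht => by
    rw [sub_nonneg, div_le_one hM]; exact ht
  have hle : ∀ n, ∫⁻ t, ENNReal.ofReal ((p n).eval t) ∂μ ≤ ENNReal.ofReal (‖v‖ ^ 2 / c) := by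
    intro n
    obtain ⟨h1, h2⟩ := integral_eval_eq_re_inner A v c μ hint h (p n)
    rw [← ofReal_integral_eq_lintegral_ofReal h1]
    · apply ENNReal.ofReal_le_ofReal
      rw [le_div_iff₀ hc, mul_comm, h2, hXp]
      simp only [map_sub, map_one, map_pow, hB, sub_apply,
        one_apply_eq_self, inner_sub_right, inner_pow_two_mul_of_isSelfAdjoint B hBs,
        Complex.sub_re, Complex.ofReal_re]
      have hv : (inner ℂ v v).re = ‖v‖ ^ 2 := inner_self_eq_norm_sq (𝕜 := ℂ) v
      have := sq_nonneg ‖(B ^ n) v‖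
      linarith
    · filter_upwards [hμ] with t ht
      rw [hp]
      have := hbase t ht.2
      simp only [Pi.zero_apply]
      positivity
  have hmono : ∀ᵐ t ∂μ, Monotone fun n => ENNReal.ofReal ((p n).eval t) := by
    filter_upwards [hμ] with t ht m n hmn
    apply ENNReal.ofReal_le_ofReal
    rw [hp, hp]
    gcongr
    exact fun i _ _ => pow_nonneg (hbase t ht.2) i
  have hlim : ∀ᵐ t ∂μ, Filter.Tendsto (fun n => ENNReal.ofReal ((p n).eval t)) Filter.atTop
      (nhds (ENNReal.ofReal t)⁻¹) := by
    filter_upwards [hμ] with t ht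
    have h2n : Filter.Tendsto (fun n : ℕ => 2 * n) Filter.atTop Filter.atTop :=
      Filter.tendsto_id.const_mul_atTop' (by norm_num)
    rcases ht.1.eq_or_lt with h0 | h0
    · subst h0
      simp only [hp, ENNReal.ofReal_zero, ENNReal.inv_zero]
      apply ENNReal.tendsto_ofReal_atTop.comp
      simp only [zero_div, sub_zero, one_pow, Finset.sum_const, Finset.card_range, nsmul_eq_mul,
        mul_one]
      exact (tendsto_natCast_atTop_atTop.comp h2n).const_mul_atTop (inv_pos.2 hM)
    · rw [← ENNReal.ofReal_inv_of_pos h0]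
      apply ENNReal.tendsto_ofReal
      have hs := (hasSum_geometric_of_lt_one (hbase t ht.2)
        (by have := div_pos h0 hM; linarith)).tendsto_sum_nat.comp h2n
      have := hs.const_mul M⁻¹
      have e : M⁻¹ * (1 - (1 - t / M))⁻¹ = t⁻¹ := by
        rw [sub_sub_cancel]
        field_simp
      rw [e] at this
      simpa only [hp, Function.comp_def] using this
  exact le_of_tendsto' (lintegral_tendsto_of_tendsto_of_monotone
    (fun n => (p n).continuous.measurable.ennreal_ofReal.aemeasurable) hmono hlim) hle

/-- Multiplication by an essentially bounded function is a normal operator on `L²`. -/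
lemma isStarNormal_holderL_mul {X : Type*} [MeasurableSpace X] (m : Measure X)
    (F : Lp ℂ ∞ m) :
    IsStarNormal ((ContinuousLinearMap.mul ℂ ℂ).holderL m ∞ 2 2 F : Lp ℂ 2 m →L[ℂ] Lp ℂ 2 m) := by
  let T : Lp ℂ ∞ m → (Lp ℂ 2 m →L[ℂ] Lp ℂ 2 m) :=
    fun G => (ContinuousLinearMap.mul ℂ ℂ).holderL m ∞ 2 2 G
  have hT : ∀ G u, T G u =ᵐ[m] fun x => G x * u x := fun G u =>
    (ContinuousLinearMap.mul ℂ ℂ).coeFn_holder G u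
  have hadj : star (T F) = T (star F) := by
    rw [ContinuousLinearMap.star_eq_adjoint]
    symm
    rw [ContinuousLinearMap.eq_adjoint_iff]
    intro u w
    rw [L2.inner_def, L2.inner_def]
    apply integral_congr_ae
    filter_upwards [hT (star F) u, hT F w, Lp.coeFn_star F] with x h1 h2 h3
    rw [h1, h2, h3]
    simp only [RCLike.inner_apply, Pi.star_apply, map_mul, RCLike.star_def, Complex.conj_conj]
    ring
  refine ⟨?_⟩
  change star (T F) * T F = T F * star (T F)
  rw [hadj]
  ext1 u
  apply Lp.ext
  change T (star F) (T F u) =ᵐ[m] T F (T (star F) u)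
  filter_upwards [hT (star F) (T F u), hT F (T (star F) u), hT F u, hT (star F) u]
    with x h1 h2 h3 h4
  rw [h1, h2, h3, h4]
  ring

/-- The characters of the circle have mean zero, except the trivial one. -/
lemma integral_fourier_eq_ite (k : ℤ) :
    ∫ x : UnitAddCircle, fourier k x ∂AddCircle.haarAddCircle = if k = 0 then 1 else 0 := by
  have h := orthonormal_iff_ite.1 (orthonormal_fourier (T := 1)) 0 k
  rw [ContinuousMap.inner_toLp] at h
  simpa [eq_comm] using h

/-- A weighted shift is subnormal as soon as an isometric copy of the weighted basis vectors is
the orbit of a vector under a normal operator. -/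
lemma isSubnormalOp_of_orthonormal {K : Type} [NormedAddCommGroup K] [InnerProductSpace ℂ K]
    [CompleteSpace K] (α : ℕ → ℝ) (W : H1 →L[ℂ] H1)
    (hW : ∀ j : ℕ, W (e1 j) = (α j : ℂ) • e1 (j + 1)) (N : K →L[ℂ] K) (hN : IsStarNormal N)
    (v : ℕ → K) (hv : Orthonormal ℂ v) (hNv : ∀ j, N (v j) = (α j : ℂ) • v (j + 1)) :
    IsSubnormalOp W := by
  let V := hv.orthogonalFamily.linearIsometry
  have hV : ∀ j, V (e1 j) = v j := fun j => by
    simp [V, e1, hv.orthogonalFamily.linearIsometry_apply_single]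
  refine ⟨K, _, _, inferInstance, V, N, hN, fun x => ?_⟩
  have key : N.comp V.toContinuousLinearMap = V.toContinuousLinearMap.comp W := by
    refine lp.ext_continuousLinearMap (by simp) fun i => ?_
    ext
    change N (V (e1 i)) = V (W (e1 i))
    rw [hV, hNv, hW, map_smul, hV]
  exact DFunLike.congr_fun key x

/-- A weighted shift with a compactly supported Berger measure is subnormal. -/
lemma isSubnormalOp_of_moments (α : ℕ → ℝ) (hα : ∀ j, 0 < α j) (W : H1 →L[ℂ] H1)
    (hW : ∀ j : ℕ, W (e1 j) = (α j : ℂ) • e1 (j + 1)) (ν : Measure ℝ) [IsProbabilityMeasure ν]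
    (R : ℝ) (hν : ∀ᵐ t ∂ν, 0 ≤ t ∧ t ≤ R)
    (hmom : ∀ k : ℕ, ∫ t, t ^ k ∂ν = ∏ j ∈ Finset.range k, α j ^ 2) :
    IsSubnormalOp W := by
  let m : Measure (ℝ × UnitAddCircle) := ν.prod AddCircle.haarAddCircle
  let f : ℝ × UnitAddCircle → ℂ := fun p => (√p.1 : ℂ) * fourier 1 p.2
  have hfc : Continuous f := by fun_prop
  have hm : ∀ᵐ p ∂m, 0 ≤ p.1 ∧ p.1 ≤ R :=
    Measure.quasiMeasurePreserving_fst.ae hν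
  have hfn : ∀ p, ‖f p‖ = √p.1 := fun p => by
    rw [norm_mul, Complex.norm_real, fourier_apply, Circle.norm_coe, mul_one,
      Real.norm_of_nonneg (Real.sqrt_nonneg _)]
  have hfb : ∀ᵐ p ∂m, ‖f p‖ ≤ √R := by
    filter_upwards [hm] with p hp
    rw [hfn]
    exact Real.sqrt_le_sqrt hp.2
  have hF : MemLp f ∞ m := memLp_top_of_bound hfc.aestronglyMeasurable _ hfb
  have hg : ∀ n : ℕ, MemLp (fun p => f p ^ n) 2 m := fun n => by
    refine MemLp.of_bound (hfc.pow n).aestronglyMeasurable (√R ^ n) ?_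
    filter_upwards [hfb] with p hp
    rw [norm_pow]
    gcongr
  let g : ℕ → Lp ℂ 2 m := fun n => (hg n).toLp
  let N : Lp ℂ 2 m →L[ℂ] Lp ℂ 2 m := (ContinuousLinearMap.mul ℂ ℂ).holderL m ∞ 2 2 (hF.toLp f)
  have hNg : ∀ n, N (g n) = g (n + 1) := fun n => by
    apply Lp.ext
    have h0 : N (g n) =ᵐ[m] fun x => hF.toLp f x * g n x :=
      (ContinuousLinearMap.mul ℂ ℂ).coeFn_holder (hF.toLp f) (g n)
    filter_upwards [h0, hF.coeFn_toLp, (hg n).coeFn_toLp, (hg (n + 1)).coeFn_toLp]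
      with p h1 h2 h3 h4
    rw [h1, h2, h3, h4, pow_succ']
  let s : ℕ → ℝ := fun n => ∏ j ∈ Finset.range n, α j
  have hs : ∀ n, s n ≠ 0 := fun n => (Finset.prod_pos fun j _ => hα j).ne'
  have hinner : ∀ i j, inner ℂ (g i) (g j) = if i = j then ((s i ^ 2 : ℝ) : ℂ) else 0 := by
    intro i j
    have h1 : inner ℂ (g i) (g j)
        = ∫ p, ((√p.1 ^ (i + j) : ℝ) : ℂ) * fourier ((j : ℤ) - i) p.2 ∂m := by
      rw [L2.inner_def]
      apply integral_congr_ae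
      filter_upwards [(hg i).coeFn_toLp, (hg j).coeFn_toLp] with p h1 h2
      rw [h1, h2]
      have hpow : ∀ n : ℕ, fourier (n : ℤ) p.2 = fourier 1 p.2 ^ n := fun n => by
        induction n with
        | zero => simp
        | succ n ih => rw [Nat.cast_succ, fourier_add, ih, pow_succ]
      rw [sub_eq_add_neg, fourier_add, fourier_neg, hpow, hpow]
      simp only [f, RCLike.inner_apply, map_mul, map_pow, Complex.conj_ofReal,
        Complex.ofReal_pow]
      ring
    rw [h1, integral_prod_mul (fun t : ℝ => ((√t ^ (i + j) : ℝ) : ℂ))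
      (fun x : UnitAddCircle => fourier ((j : ℤ) - i) x), integral_fourier_eq_ite]
    by_cases hij : i = j
    · subst hij
      have : ∫ t, √t ^ (i + i) ∂ν = s i ^ 2 := by
        rw [← Finset.prod_pow, ← hmom]
        apply integral_congr_ae
        filter_upwards [hν] with t ht
        rw [← two_mul, pow_mul, Real.sq_sqrt ht.1]
      rw [integral_complex_ofReal, this]
      simp
    · have : (j : ℤ) - i ≠ 0 := by omega
      simp [hij, this]
  refine isSubnormalOp_of_orthonormal α W hW N (isStarNormal_holderL_mul m _)
    (fun n => ((s n : ℂ)⁻¹) • g n) ?_ fun j => ?_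
  · rw [orthonormal_iff_ite]
    intro i j
    rw [inner_smul_left, inner_smul_right, hinner]
    split_ifs with hij
    · subst hij
      have := Complex.ofReal_ne_zero.2 (hs i)
      rw [map_inv₀, Complex.conj_ofReal]
      push_cast
      field_simp
    · simp
  · rw [map_smul, hNg, smul_smul]
    congr 1
    have h1 := Complex.ofReal_ne_zero.2 (hs j)
    have h2 := Complex.ofReal_ne_zero.2 (hα j).ne'
    have h3 : s (j + 1) = s j * α j := Finset.prod_range_succ _ _
    rw [h3]
    push_cast
    field_simp

/-- Powers are integrable for a finite measure carried by `[0, R]`. -/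
lemma integrable_pow_of_ae_bounded (μ : Measure ℝ) [IsFiniteMeasure μ] (R : ℝ)
    (hμ : ∀ᵐ t ∂μ, 0 ≤ t ∧ t ≤ R) (k : ℕ) : Integrable (fun t : ℝ => t ^ k) μ := by
  refine Integrable.of_bound (by fun_prop) (R ^ k) ?_
  filter_upwards [hμ] with t ht
  rw [Real.norm_of_nonneg (pow_nonneg ht.1 k)]
  exact pow_le_pow_left₀ ht.1 ht.2 k

/-- The Berger measure of a backward extension: if `c ∫ 1/t ∂μ ≤ 1`, there is a probability
measure `ν` with `t ν = c μ`. -/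
lemma exists_backward_measure (μ : Measure ℝ) [IsProbabilityMeasure μ] (R : ℝ) (hR : 0 ≤ R)
    (hμ : ∀ᵐ t ∂μ, 0 ≤ t ∧ t ≤ R) (c : ℝ) (hc : 0 ≤ c)
    (hfin : ∫⁻ t, (ENNReal.ofReal t)⁻¹ ∂μ ≠ ⊤)
    (hle : ENNReal.ofReal c * ∫⁻ t, (ENNReal.ofReal t)⁻¹ ∂μ ≤ 1) :
    ∃ ν : Measure ℝ, IsProbabilityMeasure ν ∧ (∀ᵐ t ∂ν, 0 ≤ t ∧ t ≤ R) ∧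
      ∀ k : ℕ, ∫ t, t ^ (k + 1) ∂ν = c * ∫ t, t ^ k ∂μ := by
  set I := ∫⁻ t, (ENNReal.ofReal t)⁻¹ ∂μ
  let g : ℝ → ℝ≥0∞ := fun t => (ENNReal.ofReal t)⁻¹
  have hgm : Measurable g := by fun_prop
  let ν : Measure ℝ :=
    ENNReal.ofReal c • μ.withDensity g + (1 - ENNReal.ofReal c * I) • Measure.dirac 0
  have hprob : IsProbabilityMeasure ν := by
    refine ⟨?_⟩
    simp only [ν, Measure.add_apply, Measure.smul_apply, smul_eq_mul, measure_univ, mul_one,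
      withDensity_apply g MeasurableSet.univ, Measure.restrict_univ]
    exact add_tsub_cancel_of_le hle
  have hsupp : ∀ᵐ t ∂ν, 0 ≤ t ∧ t ≤ R := by
    rw [ae_add_measure_iff]
    refine ⟨Measure.ae_smul_measure ((withDensity_absolutelyContinuous μ g).ae_le hμ) _,
      Measure.ae_smul_measure ?_ _⟩
    rw [ae_dirac_iff (measurableSet_Icc (a := (0 : ℝ)) (b := R))]
    exact ⟨le_rfl, hR⟩
  refine ⟨ν, hprob, hsupp, fun k => ?_⟩
  have hint := integrable_pow_of_ae_bounded ν R hsupp (k + 1)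
  have hglt : ∀ᵐ t ∂μ, g t < ⊤ := ae_lt_top hgm hfin
  rw [integral_add_measure hint.left_of_add_measure hint.right_of_add_measure,
    integral_smul_measure, integral_smul_measure, integral_dirac,
    integral_withDensity_eq_integral_toReal_smul hgm hglt, ENNReal.toReal_ofReal hc,
    zero_pow k.succ_ne_zero, smul_zero, add_zero, smul_eq_mul]
  congr 1
  apply integral_congr_ae
  filter_upwards [hglt, hμ] with t h1 h2
  have h0 : 0 < t := by
    by_contra h
    simp [g, ENNReal.ofReal_of_nonpos (not_lt.1 h)] at h1
  simp only [g, ENNReal.toReal_inv, ENNReal.toReal_ofReal h2.1, smul_eq_mul]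
  field_simp
  exact pow_succ' t k

/-- Subnormal backward extension for unilateral weighted shifts: if `shift(α₁,α₂,…)` is
subnormal with Berger measure `μ`, then `W_α` is subnormal iff `1/t ∈ L¹(μ)` and
`α₀² ‖1/t‖_{L¹(μ)} ≤ 1`. -/
theorem backward_extension_criterion
    (α : ℕ → ℝ) (hαpos : ∀ j, 0 < α j) (hαbdd : ∃ C : ℝ, ∀ j, α j ≤ C)
    (W : H1 →L[ℂ] H1) (hW : ∀ j : ℕ, W (e1 j) = (α j : ℂ) • e1 (j + 1))
    (μ : Measure ℝ) [IsProbabilityMeasure μ]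
    (hμ0 : μ (Set.Iio 0) = 0) (hμc : ∃ R : ℝ, μ (Set.Ioi R) = 0)
    (hμmom : ∀ k : ℕ, (∏ j ∈ Finset.range k, α (j + 1) ^ 2) = ∫ t, t ^ k ∂μ) :
    IsSubnormalOp W ↔
      ((∫⁻ t, (ENNReal.ofReal t)⁻¹ ∂μ) ≠ ⊤ ∧
        ENNReal.ofReal (α 0 ^ 2) * (∫⁻ t, (ENNReal.ofReal t)⁻¹ ∂μ) ≤ 1) := by
  obtain ⟨R, hR⟩ := hμc
  have hμ : ∀ᵐ t ∂μ, 0 ≤ t ∧ t ≤ max R 1 := by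
    have h1 : ∀ᵐ t ∂μ, t ∉ Set.Iio (0 : ℝ) := measure_eq_zero_iff_ae_notMem.1 hμ0
    have h2 : ∀ᵐ t ∂μ, t ∉ Set.Ioi R := measure_eq_zero_iff_ae_notMem.1 hR
    filter_upwards [h1, h2] with t h1 h2
    exact ⟨not_lt.1 h1, le_max_of_le_left (not_lt.1 h2)⟩
  have hM : (0 : ℝ) < max R 1 := lt_max_of_lt_right one_pos
  have hα0 : 0 < α 0 ^ 2 := pow_pos (hαpos 0) 2
  constructor
  · rintro ⟨K, _, _, _, V, N, hN, hNV⟩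
    have hle : ∫⁻ t, (ENNReal.ofReal t)⁻¹ ∂μ ≤ ENNReal.ofReal (‖V (e1 0)‖ ^ 2 / α 0 ^ 2) := by
      refine lintegral_inv_le_of_moments (star N * N) (IsSelfAdjoint.star_mul_self N) (V (e1 0))
        (α 0 ^ 2) hα0 μ (max R 1) hM hμ (integrable_pow_of_ae_bounded μ _ hμ) fun k => ?_
      rw [inner_pow_star_mul_self N hN, norm_pow_extension_apply α W hW V N hNV,
        Finset.prod_range_succ', hμmom, mul_comm]
    have he : ‖V (e1 0)‖ = 1 := by simp [e1, lp.norm_single]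
    refine ⟨(hle.trans_lt ENNReal.ofReal_lt_top).ne, (mul_le_mul_right hle _).trans ?_⟩
    rw [← ENNReal.ofReal_mul hα0.le, he, one_pow, mul_one_div_cancel hα0.ne', ENNReal.ofReal_one]
  · rintro ⟨hfin, hle⟩
    obtain ⟨ν, hν, hsupp, hmom⟩ :=
      exists_backward_measure μ (max R 1) hM.le hμ (α 0 ^ 2) hα0.le hfin hle
    refine isSubnormalOp_of_moments α hαpos W hW ν (max R 1) hsupp fun k => ?_
    cases k with
    | zero => simp
    | succ k => rw [hmom, Finset.prod_range_succ', hμmom, mul_comm]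

end
end
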